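/- Assume (T1) α|μ| > |1−αδ|, (T2) μ² > 4(1−αδ), (T3) μ > 0. For z ∈ (z_L, 0) define I₀ᶜ(z) := −(π/2)Φ′(z) + Im ∫₀^{z_P} Φ₊′(s)/(s−z) ds, where Φ₊′ is the boundary value of Φ′ from the upper half-plane, and for t ≥ 0 define F_t(z) := ((1−4z)/α)·t − (α/(2π))·I₀ᶜ(z). Then for each t ≥ 0: (i) F_t(z) → +∞ as z ↓ z_L and as z ↑ 0; (ii) F_t has exactly one critical point z_c(t) in (z_L, 0), and z_c(t) is the unique global minimizer of F_t on (z_L, 0); (iii) the function x_c(t) := min_{z_L<z<0} F_t(z) is finite and depends smoothly on t ∈ [0,∞). -/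

import Mathlib

open Complex Real Filter Set MeasureTheory ComplexConjugate Topology

noncomputable section

/-- The inverse hyperbolic tangent. -/
def arctanh (x : ℝ) : ℝ := Real.log ((1 + x) / (1 - x)) / 2

/-- The hyperbolic secant. -/
def sech (x : ℝ) : ℝ := 1 / Real.cosh x

/-- The point `z_P = (1-αδ+αμ)/4`. -/
def zP (α δ μ : ℝ) : ℝ := (1 - α*δ + α*μ)/4

/-- The point `z_∞ = (1-αδ-αμ)/4`. -/
def zInf (α δ μ : ℝ) : ℝ := (1 - α*δ - α*μ)/4

/-- The discriminant `α⁴ + α²μ²/4 − α²(1−αδ)`. -/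
def discrm (α δ μ : ℝ) : ℝ := α^4 + α^2*μ^2/4 - α^2*(1 - α*δ)

/-- The point `z⁺`. -/
def zplus (α δ μ : ℝ) : ℝ := (1/2)*((1 - α*δ)/2 - α^2 + Real.sqrt (discrm α δ μ))

/-- The point `z⁻ = z_L`. -/
def zminus (α δ μ : ℝ) : ℝ := (1/2)*((1 - α*δ)/2 - α^2 - Real.sqrt (discrm α δ μ))

/-- `Ω(z) = (2/(iα))(z − (1−αδ)/4)`. -/
def Omg (α δ : ℝ) (z : ℂ) : ℂ := (2 / (Complex.I * α)) * (z - (1 - α * δ) / 4)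

/-- `R(z) = e^{iπ/4}(−i(16z−μ²))^{1/2}` (principal branch). -/
def Rf (μ : ℝ) (z : ℂ) : ℂ :=
  Complex.exp (Complex.I * (π : ℂ) / 4) * (-Complex.I * (16 * z - (μ:ℂ)^2)) ^ ((1:ℂ)/2)

/-- The reflection coefficient `s(z)` (Gamma-function formula). -/
def sRef (α δ μ ε : ℝ) (z : ℂ) : ℂ :=
  -(((2:ℂ) ^ (-(Complex.I * (μ:ℂ)) / (ε:ℂ)) * Complex.I * (ε:ℂ)) /
      (2 * Complex.exp (Complex.I * (π : ℂ) / 4) * (-Complex.I * z) ^ ((1:ℂ)/2))) *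
    (Complex.Gamma (1/2 - Complex.I * (μ:ℂ) / (2*ε) - Omg α δ z / ε) /
      Complex.Gamma (1/2 + Complex.I * (μ:ℂ) / (2*ε) + Omg α δ z / ε)) *
    ((Complex.Gamma (1/2 + Omg α δ z / ε - Rf μ z / (2*ε)) *
      Complex.Gamma (1/2 + Omg α δ z / ε + Rf μ z / (2*ε))) /
      (Complex.Gamma (-(Complex.I * (μ:ℂ)) / (2*ε) - Rf μ z / (2*ε)) *
        Complex.Gamma (-(Complex.I * (μ:ℂ)) / (2*ε) + Rf μ z / (2*ε))))

/-- The phase function `Φ(z)` obtained from Stirling asymptotics (principal branches). -/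
def Phi (α δ μ : ℝ) (z : ℂ) : ℂ :=
  -(μ:ℂ) * Complex.log 2
  + (4/(α:ℂ)) * (z - (zP α δ μ : ℂ)) * Complex.log ((2/(α:ℂ)) * ((zP α δ μ : ℂ) - z))
  + (((μ:ℂ) - Complex.I * Rf μ z)/2) * Complex.log ((-Complex.I * (μ:ℂ) - Rf μ z)/2)
  + (((μ:ℂ) + Complex.I * Rf μ z)/2) * Complex.log ((-Complex.I * (μ:ℂ) + Rf μ z)/2)
  - Complex.I * (Omg α δ z - Rf μ z / 2) * Complex.log (Omg α δ z - Rf μ z / 2)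
  - Complex.I * (Omg α δ z + Rf μ z / 2) * Complex.log (Omg α δ z + Rf μ z / 2)

/-- `I₀ᶜ(z) = −(π/2)Φ′(z) + Im ∫₀^{z_P} Φ₊′(s)/(s−z) ds`, where `Φp` is the boundary
value of `Φ′` from the upper half-plane. -/
def I0c (α δ μ : ℝ) (Φp : ℝ → ℂ) (z : ℝ) : ℝ :=
  -(π/2) * (deriv (Phi α δ μ) (z:ℂ)).re
    + (∫ s in (0:ℝ)..(zP α δ μ), Φp s / ((s:ℂ) - (z:ℂ))).im

/-- `F_t(z) = ((1−4z)/α)t − (α/(2π))I₀ᶜ(z)`. -/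
def Ft (α δ μ : ℝ) (Φp : ℝ → ℂ) (t z : ℝ) : ℝ :=
  ((1 - 4*z)/α) * t - (α/(2*π)) * I0c α δ μ Φp z


/-- the phase in the x variable -/
def fX (α m : ℝ) (g : ℝ → ℝ) (t x : ℝ) : ℝ := (1 + (x^2 - m^2)/4)/α * t + g x

lemma fX_hasDeriv (α m : ℝ) (g gd : ℝ → ℝ) (t x : ℝ) (hg : HasDerivAt g (gd x) x) :
    HasDerivAt (fX α m g t) (x/(2*α)*t + gd x) x := by
  unfold fX
  have h1 : HasDerivAt (fun x : ℝ => (1 + (x^2 - m^2)/4)/α * t) (x/(2*α)*t) x := by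
    have := (((((hasDerivAt_id x).pow 2).sub_const (m^2)).div_const 4).const_add 1).div_const α
    have := this.mul_const t
    refine this.congr_deriv ?_
    simp only [id]
    ring
  exact h1.add hg

lemma abs_tendsto (α m : ℝ) (g : ℝ → ℝ) (t x : ℝ) (l : Filter ℝ) (hl : l ≤ 𝓝 x)
    (hg : Tendsto g l atTop) : Tendsto (fX α m g t) l atTop := by
  unfold fX
  refine Tendsto.add_atTop (C := (1 + (x^2 - m^2)/4)/α * t) ?_ hg
  have : Continuous (fun x : ℝ => (1 + (x^2 - m^2)/4)/α * t) := by fun_prop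
  exact (this.tendsto x).mono_left hl

lemma abs_exists_min (a b : ℝ) (hab : a < b) (f : ℝ → ℝ) (hc : ContinuousOn f (Ioo a b))
    (h1 : Tendsto f (𝓝[>] a) atTop) (h2 : Tendsto f (𝓝[<] b) atTop) :
    ∃ c ∈ Ioo a b, ∀ x ∈ Ioo a b, f c ≤ f x := by
  have e1 := h1.eventually (eventually_ge_atTop (f ((a+b)/2)))
  have e2 := h2.eventually (eventually_ge_atTop (f ((a+b)/2)))
  rw [eventually_iff, mem_nhdsGT_iff_exists_Ioo_subset' hab] at e1
  rw [eventually_iff, mem_nhdsLT_iff_exists_Ioo_subset' hab] at e2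
  obtain ⟨u, hu, hu'⟩ := e1
  obtain ⟨v, hv, hv'⟩ := e2
  simp only [mem_Ioi, mem_Iio] at hu hv
  set u' := min u ((a+b)/2) with hu1
  set v' := max v ((a+b)/2) with hv1
  have a1 : a < u' := lt_min hu (by linarith)
  have b1 : v' < b := max_lt hv (by linarith)
  have u2 : u' ≤ (a+b)/2 := min_le_right _ _
  have v2 : (a+b)/2 ≤ v' := le_max_right _ _
  have hcc : ContinuousOn f (Icc u' v') := hc.mono (fun x hx => ⟨by linarith [hx.1], by linarith [hx.2]⟩)
  obtain ⟨c, hc1, hc2⟩ := isCompact_Icc.exists_isMinOn (nonempty_Icc.2 (u2.trans v2)) hcc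
  refine ⟨c, ⟨by linarith [hc1.1], by linarith [hc1.2]⟩, fun x hx => ?_⟩
  have hmid : f c ≤ f ((a+b)/2) := hc2 ⟨u2, v2⟩
  by_cases hxu : x < u'
  · exact hmid.trans (hu' ⟨hx.1, hxu.trans_le (min_le_left _ _)⟩)
  by_cases hxv : v' < x
  · exact hmid.trans (hv' ⟨(le_max_left _ _).trans_lt hxv, hx.2⟩)
  exact hc2 ⟨not_lt.1 hxu, not_lt.1 hxv⟩

lemma abs_uniq {α p m b κ : ℝ} (hα : 0 < α) (hp : 0 ≤ p) (hpm : p < m) (hκ : 0 < κ) {gd : ℝ → ℝ}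
    (hh : ∀ x y, m < x → x < y → y < b →
      κ * (y - x) ≤ (y^2 - p^2) * gd y / (2*y) - (x^2 - p^2) * gd x / (2*x))
    {t x y : ℝ} (ht : 0 ≤ t) (hx : m < x) (hxy : x < y) (hy : y < b)
    (h1 : x/(2*α)*t + gd x = 0) (h2 : y/(2*α)*t + gd y = 0) : False := by
  have := hh x y hx hxy hy
  have g1 : gd x = -(x/(2*α)*t) := by linarith
  have g2 : gd y = -(y/(2*α)*t) := by linarith
  have x0 : 0 < x := by linarith
  have y0 : 0 < y := by linarith
  have e1 : (x^2 - p^2) * gd x / (2*x) = -((x^2-p^2)*(t/(4*α))) := by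
    rw [g1]; field_simp; ring
  have e2 : (y^2 - p^2) * gd y / (2*y) = -((y^2-p^2)*(t/(4*α))) := by
    rw [g2]; field_simp; ring
  rw [e1, e2] at this
  have k : 0 < κ * (y - x) := mul_pos hκ (by linarith)
  have : 0 ≤ (y^2 - x^2) * (t/(4*α)) := by
    apply mul_nonneg
    · nlinarith
    · positivity
  nlinarith

theorem abs_main {α p m b κ : ℝ} (hα : 0 < α) (hp : 0 ≤ p) (hpm : p < m) (hmb : m < b) (hκ : 0 < κ)
    {g gd : ℝ → ℝ} (hg : ∀ x ∈ Ioo m b, HasDerivAt g (gd x) x)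
    (hgd : ∀ x ∈ Ioo m b, ContDiffAt ℝ (⊤ : ℕ∞) gd x)
    (hgc : ∀ x ∈ Ioo m b, ContDiffAt ℝ (⊤ : ℕ∞) g x)
    (hh : ∀ x y, m < x → x < y → y < b →
      κ * (y - x) ≤ (y^2 - p^2) * gd y / (2*y) - (x^2 - p^2) * gd x / (2*x))
    (h1 : Tendsto g (𝓝[>] m) atTop) (h2 : Tendsto g (𝓝[<] b) atTop) :
    (∀ t, 0 ≤ t → ∃ xc ∈ Ioo m b, deriv (fX α m g t) xc = 0 ∧
      (∀ x ∈ Ioo m b, deriv (fX α m g t) x = 0 → x = xc) ∧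
      (∀ x ∈ Ioo m b, x ≠ xc → fX α m g t xc < fX α m g t x) ∧
      fX α m g t xc = sInf (fX α m g t '' Ioo m b)) ∧
    ContDiffOn ℝ (⊤ : ℕ∞) (fun t => sInf (fX α m g t '' Ioo m b)) (Ici 0) := by
  have hder : ∀ t, ∀ x ∈ Ioo m b, deriv (fX α m g t) x = x/(2*α)*t + gd x := fun t x hx =>
    (fX_hasDeriv α m g gd t x (hg x hx)).deriv
  have huniq : ∀ t, 0 ≤ t → ∀ x ∈ Ioo m b, ∀ y ∈ Ioo m b,
      x/(2*α)*t + gd x = 0 → y/(2*α)*t + gd y = 0 → x = y := by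
    intro t ht x hx y hy e1 e2
    rcases lt_trichotomy x y with h | h | h
    · exact (abs_uniq hα hp hpm hκ hh ht hx.1 h hy.2 e1 e2).elim
    · exact h
    · exact (abs_uniq hα hp hpm hκ hh ht hy.1 h hx.2 e2 e1).elim
  have hmin : ∀ t, 0 ≤ t → ∃ xc ∈ Ioo m b, xc/(2*α)*t + gd xc = 0 ∧
      (∀ x ∈ Ioo m b, fX α m g t xc ≤ fX α m g t x) := by
    intro t ht
    obtain ⟨c, hc, hc'⟩ := abs_exists_min m b hmb (fX α m g t)
      (fun x hx => (fX_hasDeriv α m g gd t x (hg x hx)).continuousAt.continuousWithinAt)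
      (abs_tendsto _ _ _ _ m _ nhdsWithin_le_nhds h1) (abs_tendsto _ _ _ _ b _ nhdsWithin_le_nhds h2)
    refine ⟨c, hc, ?_, hc'⟩
    have : IsLocalMin (fX α m g t) c := by
      filter_upwards [isOpen_Ioo.mem_nhds hc] with x hx using hc' x hx
    rw [← hder t c hc]; exact this.deriv_eq_zero
  have hsInf : ∀ t, 0 ≤ t → ∀ x ∈ Ioo m b, x/(2*α)*t + gd x = 0 →
      sInf (fX α m g t '' Ioo m b) = fX α m g t x := by
    intro t ht x hx e
    obtain ⟨c, hc, e', hc'⟩ := hmin t ht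
    obtain rfl := huniq t ht x hx c hc e e'
    apply IsLeast.csInf_eq
    exact ⟨⟨x, hx, rfl⟩, by rintro _ ⟨y, hy, rfl⟩; exact hc' y hy⟩
  constructor
  · intro t ht
    obtain ⟨c, hc, e, hc'⟩ := hmin t ht
    refine ⟨c, hc, by rw [hder t c hc, e], ?_, ?_, (hsInf t ht c hc e).symm⟩
    · intro x hx hx'
      rw [hder t x hx] at hx'
      exact huniq t ht x hx c hc hx' e
    · intro x hx hne
      refine lt_of_le_of_ne (hc' x hx) (fun heq => hne ?_)
      have : IsLocalMin (fX α m g t) x := by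
        filter_upwards [isOpen_Ioo.mem_nhds hx] with y hy using heq ▸ hc' y hy
      have := this.deriv_eq_zero
      rw [hder t x hx] at this
      exact huniq t ht x hx c hc this e
  · intro t0 ht0
    have ht0 : 0 ≤ t0 := ht0
    obtain ⟨c, hc, e, hc'⟩ := hmin t0 ht0
    have c0 : 0 < c := by linarith [hc.1]
    have cp : 0 < c^2 - p^2 := by nlinarith [hc.1]
    set q : ℝ → ℝ := fun x => -2*α*gd x/x with hq
    have hqc : ContDiffAt ℝ (⊤ : ℕ∞) q c := by
      apply ContDiffAt.div
      · exact contDiffAt_const.mul (hgd c hc)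
      · exact contDiffAt_id
      · exact c0.ne'
    have hgdd : HasDerivAt gd (deriv gd c) c :=
      ((hgd c hc).differentiableAt (by simp)).hasDerivAt
    set H : ℝ → ℝ := fun x => (x^2 - p^2) * gd x / (2*x) with hH
    have hHd : HasDerivAt H (((2*c)*gd c + (c^2-p^2)*deriv gd c)/(2*c) - (c^2-p^2)*gd c*2/(2*c)^2) c := by
      have := ((((hasDerivAt_id c).pow 2).sub_const (p^2)).mul hgdd).div ((hasDerivAt_id c).const_mul 2)
        (by simpa using c0.ne')
      refine this.congr_deriv ?_
      simp only [id, Pi.pow_apply, Pi.mul_apply]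
      field_simp
      ring
    have hHpos : κ ≤ deriv H c := by
      have hmono : MonotoneOn (fun x => H x - κ * x) (Ioo m b) := by
        intro x hx y hy hxy
        rcases hxy.eq_or_lt with h | h
        · rw [h]
        · have := hh x y hx.1 h hy.2
          simp only [hH]; linarith
      have := hmono.derivWithin_nonneg (x := c)
      rw [derivWithin_of_isOpen isOpen_Ioo hc] at this
      have e3 : HasDerivAt (fun x => H x - κ * x) (deriv H c - κ) c := by
        have := hHd.differentiableAt.hasDerivAt.sub ((hasDerivAt_id c).const_mul κ)
        exact this.congr_deriv (by simp)
      rw [e3.deriv] at this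
      linarith
    rw [hHd.deriv] at hHpos
    have hq' : HasDerivAt q (-2*α*(deriv gd c)/c + 2*α*gd c/c^2) c := by
      have := (hgdd.const_mul (-2*α)).div (hasDerivAt_id c) (by simpa using c0.ne')
      refine this.congr_deriv ?_
      simp only [id]
      field_simp
      ring
    have hgneg : gd c ≤ 0 := by
      have : 0 ≤ c/(2*α)*t0 := by positivity
      linarith
    have hq0 : -2*α*(deriv gd c)/c + 2*α*gd c/c^2 ≠ 0 := by
      intro h0
      have h3 : deriv gd c = gd c / c := by
        field_simp at h0
        field_simp
        have h7 : 2*α ≠ 0 := by positivity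
        have h8 : -(deriv gd c * c) + gd c = 0 := by
          apply mul_left_cancel₀ h7; rw [h0]; ring
        linarith
      rw [h3] at hHpos
      have : ((2*c)*gd c + (c^2-p^2)*(gd c / c))/(2*c) - (c^2-p^2)*gd c*2/(2*c)^2 = gd c := by
        field_simp
        ring
      rw [this] at hHpos
      linarith
    set e' : ℝ ≃L[ℝ] ℝ := ContinuousLinearEquiv.unitsEquivAut ℝ (Units.mk0 _ hq0) with he'
    have hqF : HasFDerivAt q (e' : ℝ →L[ℝ] ℝ) c := hq'.hasFDerivAt_equiv hq0
    have hn : ((⊤ : ℕ∞) : WithTop ℕ∞) ≠ 0 := by simp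
    have hqc0 : q c = t0 := by
      have : gd c = - (c/(2*α)*t0) := by linarith
      simp only [hq, this]; field_simp
    set ψ := hqc.localInverse hqF hn with hψ
    have hψc : ContDiffAt ℝ (⊤ : ℕ∞) ψ t0 := by
      have := hqc.to_localInverse hqF hn
      rwa [hqc0] at this
    have hψ0 : ψ t0 = c := by
      have := hqc.localInverse_apply_image hqF hn
      rwa [hqc0] at this
    have hψr : ∀ᶠ t in 𝓝 t0, q (ψ t) = t := by
      have := (hqc.hasStrictFDerivAt' hqF hn).eventually_right_inverse
      rwa [hqc0] at this
    have hψm : ∀ᶠ t in 𝓝 t0, ψ t ∈ Ioo m b :=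
      hψc.continuousAt.eventually (by rw [hψ0]; exact isOpen_Ioo.mem_nhds hc)
    have hcd : ContDiffAt ℝ (⊤ : ℕ∞) (fun t => fX α m g t (ψ t)) t0 := by
      unfold fX
      have h4 : ContDiffAt ℝ (⊤ : ℕ∞) (fun t => g (ψ t)) t0 :=
        ContDiffAt.comp t0 (by rw [hψ0]; exact hgc c hc) hψc
      have h5 : ContDiffAt ℝ (⊤ : ℕ∞) (fun t => (1 + ((ψ t)^2 - m^2)/4)/α * t) t0 := by
        fun_prop
      exact h5.add h4
    refine hcd.contDiffWithinAt.congr_of_eventuallyEq_of_mem ?_ ht0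
    have hev : ∀ᶠ t in 𝓝[Ici 0] t0, (q (ψ t) = t ∧ ψ t ∈ Ioo m b) :=
      (hψr.and hψm).filter_mono nhdsWithin_le_nhds
    filter_upwards [hev, self_mem_nhdsWithin] with t ht ht'
    apply hsInf t ht' _ ht.2
    have h6 := ht.1
    have p0 : 0 < ψ t := by linarith [ht.2.1]
    simp only [hq] at h6
    generalize gd (ψ t) = G at *
    field_simp at h6
    field_simp
    linarith

/-- explicit profile -/
def gX (α p m x : ℝ) : ℝ :=
  1/2*(Real.log (x-p) + Real.log (x+p)) - 1/2*(Real.log (p+4*α-x) + Real.log (p+4*α+x))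
  + (α/x)*(Real.log (x+m) - Real.log (x-m) - Real.log (x+p) + Real.log (x-p)
     - Real.log (p+4*α+x) + Real.log (p+4*α-x))

/-- its derivative -/
def gdX (α p m x : ℝ) : ℝ :=
  1/2*(1/(x-p) + 1/(x+p)) - 1/2*(-1/(p+4*α-x) + 1/(p+4*α+x))
  - (α/x^2)*(Real.log (x+m) - Real.log (x-m) - Real.log (x+p) + Real.log (x-p)
     - Real.log (p+4*α+x) + Real.log (p+4*α-x))
  + (α/x)*(1/(x+m) - 1/(x-m) - 1/(x+p) + 1/(x-p)
     - 1/(p+4*α+x) + (-1)/(p+4*α-x))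

lemma gX_hasDeriv {α p m x : ℝ} (hα : 0 < α) (hp : 0 < p) (hpm : p < m)
    (hx : m < x) (hxb : x < p+4*α) : HasDerivAt (gX α p m) (gdX α p m x) x := by
  have i := hasDerivAt_id x
  have l1 := (i.sub_const p).log (by simp only [id]; linarith)
  have l2 := (i.add_const p).log (by simp only [id]; linarith)
  have l3 := (i.const_sub (p+4*α)).log (by simp only [id]; linarith)
  have l4 := (i.const_add (p+4*α)).log (by simp only [id]; linarith)
  have l5 := (i.sub_const m).log (by simp only [id]; linarith)
  have l6 := (i.add_const m).log (by simp only [id]; linarith)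
  have l7 := (hasDerivAt_const x α).div i (by simp only [id]; linarith)
  have := (((l1.add l2).const_mul (1/2)).sub ((l3.add l4).const_mul (1/2))).add
    (l7.mul (((((l6.sub l5).sub l2).add l1).sub l4).add l3))
  refine HasDerivAt.congr_deriv (this : HasDerivAt (gX α p m) _ x) ?_
  simp only [id, gdX, Pi.sub_apply, Pi.add_apply, Pi.div_apply]
  ring

lemma gX_contDiff {α p m x : ℝ} (hp : 0 < p) (hpm : p < m)
    (hx : m < x) (hxb : x < p+4*α) : ContDiffAt ℝ (⊤ : ℕ∞) (gX α p m) x := by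
  unfold gX
  have a1 : x - p ≠ 0 := by linarith
  have a2 : x + p ≠ 0 := by linarith
  have a3 : p+4*α - x ≠ 0 := by linarith
  have a4 : p+4*α + x ≠ 0 := by linarith
  have a5 : x - m ≠ 0 := by linarith
  have a6 : x + m ≠ 0 := by linarith
  have a7 : x ≠ 0 := by linarith
  fun_prop (disch := assumption)

lemma gdX_contDiff {α p m x : ℝ} (hp : 0 < p) (hpm : p < m)
    (hx : m < x) (hxb : x < p+4*α) : ContDiffAt ℝ (⊤ : ℕ∞) (gdX α p m) x := by
  unfold gdX
  have a1 : x - p ≠ 0 := by linarith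
  have a2 : x + p ≠ 0 := by linarith
  have a3 : p+4*α - x ≠ 0 := by linarith
  have a4 : p+4*α + x ≠ 0 := by linarith
  have a5 : x - m ≠ 0 := by linarith
  have a6 : x + m ≠ 0 := by linarith
  have a7 : x ≠ 0 := by linarith
  have a8 : x^2 ≠ 0 := pow_ne_zero _ a7
  fun_prop (disch := assumption)

lemma gX_tendsto_m {α p m : ℝ} (hα : 0 < α) (hp : 0 < p) (hpm : p < m) (hmb : m < p + 4*α) :
    Tendsto (gX α p m) (𝓝[>] m) atTop := by
  have key : Tendsto (fun x : ℝ => (α/x) * (-Real.log (x-m)) + (gX α p m x - (α/x) * (-Real.log (x-m))))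
      (𝓝[>] m) atTop := by
    have hrest : (fun x => gX α p m x - (α/x) * (-Real.log (x-m))) = fun x =>
      1/2*(Real.log (x-p) + Real.log (x+p)) - 1/2*(Real.log (p+4*α-x) + Real.log (p+4*α+x))
  + (α/x)*(Real.log (x+m) - Real.log (x+p) + Real.log (x-p)
     - Real.log (p+4*α+x) + Real.log (p+4*α-x)) := by
      funext x; unfold gX; ring
    have hcont : ContinuousAt (fun x => gX α p m x - (α/x) * (-Real.log (x-m))) m := by
      rw [hrest]
      have a1 : m - p ≠ 0 := by linarith
      have a2 : m + p ≠ 0 := by linarith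
      have a3 : p+4*α - m ≠ 0 := by linarith
      have a4 : p+4*α + m ≠ 0 := by linarith
      have a6 : m + m ≠ 0 := by linarith
      have a7 : m ≠ 0 := by linarith
      fun_prop (disch := assumption)
    refine Tendsto.atTop_add ?_ (hcont.tendsto.mono_left nhdsWithin_le_nhds)
    have m0 : 0 < m := by linarith
    refine Tendsto.pos_mul_atTop (C := α/m) (by positivity) ?_ ?_
    · have : ContinuousAt (fun x : ℝ => α/x) m := by
        have a7 : m ≠ 0 := by linarith
        fun_prop (disch := assumption)
      exact this.tendsto.mono_left nhdsWithin_le_nhds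
    · refine tendsto_neg_atBot_atTop.comp ?_
      refine Real.tendsto_log_nhdsGT_zero.comp ?_
      refine tendsto_nhdsWithin_iff.2 ⟨?_, ?_⟩
      · have : Continuous (fun x : ℝ => x - m) := by fun_prop
        have := (this.tendsto m).mono_left (nhdsWithin_le_nhds (s := Ioi m))
        simpa using this
      · filter_upwards [self_mem_nhdsWithin] with x hx
        simp only [mem_Ioi] at *; linarith
  refine key.congr (fun x => by ring)

lemma gX_tendsto_b {α p m : ℝ} (hα : 0 < α) (hp : 0 < p) (hpm : p < m) (hmb : m < p + 4*α) :
    Tendsto (gX α p m) (𝓝[<] (p+4*α)) atTop := by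
  set b := p + 4*α with hb
  have key : Tendsto (fun x : ℝ => (1/2-α/x) * (-Real.log (b-x)) + (gX α p m x - (1/2-α/x) * (-Real.log (b-x))))
      (𝓝[<] b) atTop := by
    have hrest : (fun x => gX α p m x - (1/2-α/x) * (-Real.log (b-x))) = fun x =>
      1/2*(Real.log (x-p) + Real.log (x+p)) - 1/2*(Real.log (b+x))
  + (α/x)*(Real.log (x+m) - Real.log (x-m) - Real.log (x+p) + Real.log (x-p)
     - Real.log (b+x)) := by
      funext x; unfold gX; rw [← hb]; ring
    have hcont : ContinuousAt (fun x => gX α p m x - (1/2-α/x) * (-Real.log (b-x))) b := by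
      rw [hrest]
      have a1 : b - p ≠ 0 := by linarith
      have a2 : b + p ≠ 0 := by linarith
      have a3 : b - m ≠ 0 := by linarith
      have a4 : b + m ≠ 0 := by linarith
      have a6 : b + b ≠ 0 := by linarith
      have a7 : b ≠ 0 := by linarith
      fun_prop (disch := assumption)
    refine Tendsto.atTop_add ?_ (hcont.tendsto.mono_left nhdsWithin_le_nhds)
    have b0 : 0 < b := by linarith
    refine Tendsto.pos_mul_atTop (C := 1/2-α/b) ?_ ?_ ?_
    · rw [sub_pos, div_lt_iff₀ b0]; linarith
    · have : ContinuousAt (fun x : ℝ => 1/2-α/x) b := by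
        have a7 : b ≠ 0 := by linarith
        fun_prop (disch := assumption)
      exact this.tendsto.mono_left nhdsWithin_le_nhds
    · refine tendsto_neg_atBot_atTop.comp ?_
      refine Real.tendsto_log_nhdsGT_zero.comp ?_
      refine tendsto_nhdsWithin_iff.2 ⟨?_, ?_⟩
      · have : Continuous (fun x : ℝ => b - x) := by fun_prop
        have := (this.tendsto b).mono_left (nhdsWithin_le_nhds (s := Iio b))
        simpa using this
      · filter_upwards [self_mem_nhdsWithin] with x hx
        simp only [mem_Iio, mem_Ioi] at *; linarith
  refine key.congr (fun x => by ring)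

lemma int1 {p m x : ℝ} (hp : 0 < p) (hpm : p < m) (hx : m < x) :
    ∫ u in p..m, 1/(x^2-u^2)^2 =
      (m/(2*x^2*(x^2-m^2)) + (Real.log (x+m) - Real.log (x-m))/(4*x^3)) -
      (p/(2*x^2*(x^2-p^2)) + (Real.log (x+p) - Real.log (x-p))/(4*x^3)) := by
  have hne : ∀ u ∈ uIcc p m, 0 < x^2-u^2 := by
    intro u hu; rw [uIcc_of_le hpm.le] at hu; nlinarith [hu.1, hu.2]
  apply intervalIntegral.integral_eq_sub_of_hasDerivAt
    (f := fun u => u/(2*x^2*(x^2-u^2)) + (Real.log (x+u) - Real.log (x-u))/(4*x^3))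
  · intro u hu
    have h0 := hne u hu
    rw [uIcc_of_le hpm.le] at hu
    have i := hasDerivAt_id u
    have x0 : 0 < x := by linarith
    have l1 := (i.const_add x).log (by simp only [id]; linarith [hu.1])
    have l2 := (i.const_sub x).log (by simp only [id]; linarith [hu.2])
    have l3 := i.div (((i.pow 2).const_sub (x^2)).const_mul (2*x^2)) (by simp only [id, Pi.pow_apply]; positivity)
    refine HasDerivAt.congr_deriv (l3.add ((l1.sub l2).div_const (4*x^3))) ?_
    simp only [id, Pi.pow_apply]
    have e1 : x^2 - u^2 = (x+u)*(x-u) := by ring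
    have n1 : x + u ≠ 0 := by linarith [hu.1]
    have n2 : x - u ≠ 0 := by linarith [hu.2]
    rw [e1]
    field_simp
    push_cast
    ring
  · apply ContinuousOn.intervalIntegrable
    intro u hu
    have h0 := (pow_pos (hne u hu) 2).ne'
    apply ContinuousAt.continuousWithinAt
    fun_prop (disch := assumption)

lemma int2 {α b x : ℝ} (hα : 0 < α) (hx : 0 < x) (hb : x < b) :
    ∫ v in (0:ℝ)..1, v*b*(b-2*α*v)/(b^2-x^2*v^2)^2 =
      1/(2*(b^2-x^2)) - 2*α*b*(1/(2*x^2*(b^2-x^2)) - (Real.log (b+x) - Real.log (b-x))/(4*b*x^3)) := by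
  have hb' : 0 < b := by linarith
  have hne : ∀ v ∈ uIcc (0:ℝ) 1, 0 < b - x*v ∧ 0 < b + x*v ∧ 0 < b^2-x^2*v^2 := by
    intro v hv; rw [uIcc_of_le zero_le_one] at hv
    have h1 : 0 < b - x*v := by nlinarith [hv.1, hv.2]
    have h2 : 0 < b + x*v := by nlinarith [hv.1, hv.2]
    exact ⟨h1, h2, by nlinarith [mul_pos h1 h2]⟩
  rw [intervalIntegral.integral_eq_sub_of_hasDerivAt
    (f := fun v => v^2/(2*(b^2-x^2*v^2)) - 2*α*b*(v/(2*x^2*(b^2-x^2*v^2))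
      - (Real.log (b+x*v) - Real.log (b-x*v))/(4*b*x^3)))]
  · simp
  · intro u hu
    obtain ⟨h1, h2, h3⟩ := hne u hu
    have i := hasDerivAt_id u
    have l1 := ((i.const_mul x).const_add b).log (by simp only [id]; exact h2.ne')
    have l2 := ((i.const_mul x).const_sub b).log (by simp only [id]; exact h1.ne')
    have l3 := (((i.pow 2).const_mul (x^2)).const_sub (b^2))
    have l4 := i.div (l3.const_mul (2*x^2)) (by simp only [id, Pi.pow_apply]; positivity)
    have l5 := (i.pow 2).div (l3.const_mul 2) (by simp only [id, Pi.pow_apply]; positivity)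
    refine HasDerivAt.congr_deriv (l5.sub ((l4.sub ((l1.sub l2).div_const (4*b*x^3))).const_mul (2*α*b))) ?_
    simp only [id, Pi.pow_apply]
    have e1 : b^2-x^2*u^2 = (b+x*u)*(b-x*u) := by ring
    rw [e1]
    have n1 := h1.ne'
    have n2 := h2.ne'
    field_simp
    push_cast
    ring
  · apply ContinuousOn.intervalIntegrable
    intro u hu
    have h0 := (pow_pos (hne u hu).2.2 2).ne'
    apply ContinuousAt.continuousWithinAt
    fun_prop (disch := assumption)

lemma h_eq {α p m x : ℝ} (hα : 0 < α) (hp : 0 < p) (hpm : p < m)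
    (hx : m < x) (hxb : x < p+4*α) :
    (x^2 - p^2) * gdX α p m x / (2*x) = 1/2 - 2*α*((x^2-p^2)*∫ u in p..m, 1/(x^2-u^2)^2)
      + (x^2-p^2)*∫ v in (0:ℝ)..1, v*(p+4*α)*((p+4*α)-2*α*v)/((p+4*α)^2-x^2*v^2)^2 := by
  rw [int1 hp hpm hx, int2 hα (by linarith) hxb]
  unfold gdX
  have n1 : x - p ≠ 0 := by linarith
  have n2 : x + p ≠ 0 := by linarith
  have n3 : x - m ≠ 0 := by linarith
  have n4 : x + m ≠ 0 := by linarith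
  set b := p + 4*α with hb
  have n5 : b - x ≠ 0 := by linarith
  have n6 : b + x ≠ 0 := by linarith
  have n7 : x ≠ 0 := by linarith
  have n8 : b ≠ 0 := by linarith
  have e1 : x^2 - p^2 = (x+p)*(x-p) := by ring
  have e2 : x^2 - m^2 = (x+m)*(x-m) := by ring
  have e3 : b^2 - x^2 = (b+x)*(b-x) := by ring
  rw [e1, e2, e3]
  generalize Real.log (x+m) = X1
  generalize Real.log (x-m) = X2
  generalize Real.log (x+p) = X3
  generalize Real.log (x-p) = X4
  generalize Real.log (b+x) = X5
  generalize Real.log (b-x) = X6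
  field_simp
  ring

lemma h_mono {α p m : ℝ} (hα : 0 < α) (hp : 0 < p) (hpm : p < m) :
    ∃ κ > 0, ∀ x y, m < x → x < y → y < p + 4*α →
      κ * (y - x) ≤ (y^2 - p^2) * gdX α p m y / (2*y) - (x^2 - p^2) * gdX α p m x / (2*x) := by
  set b := p + 4*α with hb
  have b0 : 0 < b := by positivity
  set I2 : ℝ → ℝ := fun x => ∫ v in (0:ℝ)..1, v*b*(b-2*α*v)/(b^2-x^2*v^2)^2 with hI2
  have hpos : ∀ x, 0 < x → x < b → ∀ v ∈ Icc (0:ℝ) 1, 0 < b^2 - x^2*v^2 := by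
    intro x hx hxb v hv
    have h1 : 0 < b - x*v := by nlinarith [hv.1, hv.2]
    have h2 : 0 < b + x*v := by nlinarith [hv.1, hv.2]
    nlinarith [mul_pos h1 h2]
  have hint : ∀ x, 0 < x → x < b → IntervalIntegrable (fun v => v*b*(b-2*α*v)/(b^2-x^2*v^2)^2) volume 0 1 := by
    intro x hx hxb
    apply ContinuousOn.intervalIntegrable
    intro u hu
    rw [uIcc_of_le zero_le_one] at hu
    have h0 := (pow_pos (hpos x hx hxb u hu) 2).ne'
    apply ContinuousAt.continuousWithinAt
    fun_prop (disch := assumption)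
  have hmono : ∀ x y, 0 < x → x < y → y < b → I2 x ≤ I2 y := by
    intro x y hx hxy hy
    apply intervalIntegral.integral_mono_on zero_le_one (hint x hx (by linarith)) (hint y (by linarith) hy)
    intro v hv
    have h1 := hpos x hx (by linarith) v hv
    have h2 := hpos y (by linarith) hy v hv
    apply div_le_div_of_nonneg_left
    · have : 0 ≤ b - 2*α*v := by nlinarith [hv.1, hv.2]
      have := hv.1
      positivity
    · positivity
    · have : x^2 ≤ y^2 := by nlinarith
      have : b^2 - y^2*v^2 ≤ b^2 - x^2*v^2 := by nlinarith [sq_nonneg v]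
      gcongr
  by_cases hmb : m < b
  swap
  · exact ⟨1, one_pos, fun x y h1 h2 h3 => by linarith⟩
  have hI2m : 0 < I2 m := by
    apply intervalIntegral.intervalIntegral_pos_of_pos_on (hint m (by linarith) hmb)
    · intro v hv
      have h1 := hpos m (by linarith) hmb v ⟨hv.1.le, hv.2.le⟩
      have : 0 < b - 2*α*v := by nlinarith [hv.1, hv.2]
      have := hv.1
      positivity
    · exact zero_lt_one
  refine ⟨I2 m * (2*m), by have : 0 < m := by linarith
                           positivity, fun x y hx hxy hy => ?_⟩
  rw [h_eq hα hp hpm hx (by linarith), h_eq hα hp hpm (by linarith) hy, ← hb]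
  have s1 : (y^2-p^2)*∫ u in p..m, 1/(y^2-u^2)^2 ≤ (x^2-p^2)*∫ u in p..m, 1/(x^2-u^2)^2 := by
    rw [← intervalIntegral.integral_const_mul, ← intervalIntegral.integral_const_mul]
    have hne : ∀ w, m < w → ∀ u ∈ Icc p m, 0 < w^2-u^2 := by
      intro w hw u hu;  nlinarith [hu.1, hu.2]
    have hi : ∀ w, m < w → IntervalIntegrable (fun u => (w^2-p^2)*(1/(w^2-u^2)^2)) volume p m := by
      intro w hw
      apply ContinuousOn.intervalIntegrable
      intro u hu
      rw [uIcc_of_le hpm.le] at hu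
      have h0 := (pow_pos (hne w hw u hu) 2).ne'
      apply ContinuousAt.continuousWithinAt
      fun_prop (disch := assumption)
    apply intervalIntegral.integral_mono_on hpm.le (hi y (by linarith)) (hi x hx)
    intro u hu
    have h1 := hne x hx u hu
    have h2 := hne y (by linarith) u hu
    have h3 : 0 ≤ u^2 - p^2 := by nlinarith [hu.1]
    have e : ∀ w, 0 < w^2-u^2 → (w^2-p^2)*(1/(w^2-u^2)^2) = 1/(w^2-u^2) + (u^2-p^2)*(1/(w^2-u^2)^2) := by
      intro w hw; field_simp; ring
    rw [e x h1, e y h2]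
    have : x^2 - u^2 ≤ y^2 - u^2 := by nlinarith
    gcongr
  have s2 : I2 m * (2*m)*(y-x) ≤ (y^2-p^2)*I2 y - (x^2-p^2)*I2 x := by
    have a1 := hmono x y (by linarith) hxy hy
    have a2 := hmono m y (by linarith) (by linarith) hy
    have a3 : 0 ≤ x^2 - p^2 := by nlinarith
    have a4 : (y^2-p^2)*I2 y - (x^2-p^2)*I2 x = (y^2-x^2)*I2 y + (x^2-p^2)*(I2 y - I2 x) := by ring
    rw [a4]
    have a5 : 0 ≤ (x^2-p^2)*(I2 y - I2 x) := mul_nonneg a3 (by linarith)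
    have a6 : (2*m)*(y-x) ≤ y^2-x^2 := by nlinarith
    have a7 : (2*m)*(y-x) * I2 m ≤ (y^2-x^2)*I2 y := by
      apply mul_le_mul a6 a2 hI2m.le
      nlinarith
    linarith
  have s3 := mul_le_mul_of_nonneg_left s1 (by positivity : (0:ℝ) ≤ 2*α)
  simp only [hI2] at s2 ⊢
  linarith

lemma Rf_sq (μ : ℝ) (z : ℂ) : Rf μ z ^ 2 = 16 * z - (μ:ℂ)^2 := by
  unfold Rf
  rw [mul_pow, ← Complex.exp_nat_mul]
  have h1 : ((2:ℕ):ℂ) * (Complex.I * (π:ℂ)/4) = (π:ℂ)/2 * Complex.I := by push_cast; ring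
  rw [h1, Complex.exp_pi_div_two_mul_I]
  have h2 : ((-Complex.I * (16 * z - (μ:ℂ)^2)) ^ ((1:ℂ)/2))^2 = (-Complex.I * (16 * z - (μ:ℂ)^2)) := by
    rw [← Complex.cpow_nat_mul]; norm_num
  rw [h2]
  linear_combination (-(16 * z - (μ:ℂ)^2)) * Complex.I_sq

lemma Rf_hasDeriv {μ : ℝ} {z : ℂ} (h : -Complex.I * (16 * z - (μ:ℂ)^2) ∈ Complex.slitPlane) :
    HasDerivAt (Rf μ) (8 / Rf μ z) z := by
  have hl : HasDerivAt (fun z : ℂ => -Complex.I * (16 * z - (μ:ℂ)^2)) (-Complex.I * 16) z := by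
    have := (((hasDerivAt_id z).const_mul 16).sub_const ((μ:ℂ)^2)).const_mul (-Complex.I)
    exact this.congr_deriv (by simp)
  have := (hl.cpow_const (c := (1:ℂ)/2) h).const_mul (Complex.exp (Complex.I * (π : ℂ) / 4))
  refine HasDerivAt.congr_deriv (f := Rf μ) this ?_
  have hw : -Complex.I * (16 * z - (μ:ℂ)^2) ≠ 0 := Complex.slitPlane_ne_zero h
  have hR0 : Rf μ z ≠ 0 := by
    intro h0
    have := Rf_sq μ z
    rw [h0] at this
    apply hw
    rw [← this]; simp
  rw [eq_div_iff hR0]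
  unfold Rf
  have e1 : (-Complex.I * (16 * z - (μ:ℂ)^2)) ^ ((1:ℂ)/2 - 1)
     = (-Complex.I * (16 * z - (μ:ℂ)^2)) ^ ((1:ℂ)/2) / (-Complex.I * (16 * z - (μ:ℂ)^2)) := by
    rw [Complex.cpow_sub _ _ hw, Complex.cpow_one]
  rw [e1]
  have h2 : ((-Complex.I * (16 * z - (μ:ℂ)^2)) ^ ((1:ℂ)/2))^2 = (-Complex.I * (16 * z - (μ:ℂ)^2)) := by
    rw [← Complex.cpow_nat_mul]; norm_num
  have h3 : (Complex.exp (Complex.I * (π : ℂ) / 4))^2 = Complex.I := by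
    rw [← Complex.exp_nat_mul]
    have h1 : ((2:ℕ):ℂ) * (Complex.I * (π:ℂ)/4) = (π:ℂ)/2 * Complex.I := by push_cast; ring
    rw [h1, Complex.exp_pi_div_two_mul_I]
  generalize Complex.exp (Complex.I * (π : ℂ) / 4) = E at *
  generalize (-Complex.I * (16 * z - (μ:ℂ)^2)) ^ ((1:ℂ)/2) = S at *
  generalize (-Complex.I * (16 * z - (μ:ℂ)^2)) = w at *
  have : E * (1 / 2 * (S / w) * (-Complex.I * 16)) * (E * S) = E^2*S^2/w * (-8*Complex.I) := by ring
  rw [this, h2, h3, mul_div_assoc, div_self hw]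
  linear_combination (-8)*Complex.I_sq

/-- explicit derivative of `Phi` -/
def PhiD (α δ μ : ℝ) (z : ℂ) : ℂ :=
  (4/(α:ℂ)) * Complex.log ((2/(α:ℂ)) * ((zP α δ μ : ℂ) - z))
  - (2/(α:ℂ)) * (Complex.log (Omg α δ z - Rf μ z / 2) + Complex.log (Omg α δ z + Rf μ z / 2))
  + (4*Complex.I/Rf μ z) * (Complex.log ((-Complex.I * (μ:ℂ) + Rf μ z)/2)
     - Complex.log ((-Complex.I * (μ:ℂ) - Rf μ z)/2)
     - Complex.log (Omg α δ z + Rf μ z / 2) + Complex.log (Omg α δ z - Rf μ z / 2))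

/-- all logarithm arguments avoid the cut -/
structure Good (α δ μ : ℝ) (z : ℂ) : Prop where
  h0 : -Complex.I * (16 * z - (μ:ℂ)^2) ∈ Complex.slitPlane
  h1 : (2/(α:ℂ)) * ((zP α δ μ : ℂ) - z) ∈ Complex.slitPlane
  h2 : (-Complex.I * (μ:ℂ) - Rf μ z)/2 ∈ Complex.slitPlane
  h3 : (-Complex.I * (μ:ℂ) + Rf μ z)/2 ∈ Complex.slitPlane
  h4 : Omg α δ z - Rf μ z / 2 ∈ Complex.slitPlane
  h5 : Omg α δ z + Rf μ z / 2 ∈ Complex.slitPlane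

lemma Good.ne {α δ μ : ℝ} {z : ℂ} (h : Good α δ μ z) : Rf μ z ≠ 0 := by
  intro h0
  have := Rf_sq μ z
  rw [h0] at this
  apply Complex.slitPlane_ne_zero h.h0
  rw [← this]; simp

lemma xlogx_deriv {f : ℂ → ℂ} {f' z : ℂ} (hf : HasDerivAt f f' z) (h : f z ∈ Complex.slitPlane) :
    HasDerivAt (fun z => f z * Complex.log (f z)) (f' * Complex.log (f z) + f') z := by
  refine (hf.mul (hf.clog h)).congr_deriv ?_
  rw [mul_div_cancel₀ _ (Complex.slitPlane_ne_zero h)]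

lemma Good.hasDeriv {α δ μ : ℝ} (hα : 0 < α) {z : ℂ} (h : Good α δ μ z) :
    HasDerivAt (Phi α δ μ) (PhiD α δ μ z) z := by
  have hα' : (α:ℂ) ≠ 0 := by exact_mod_cast hα.ne'
  have dR := Rf_hasDeriv h.h0
  have dO : HasDerivAt (Omg α δ) (2/(Complex.I*α)) z := by
    have := ((hasDerivAt_id z).sub_const (((1:ℂ) - α * δ)/4)).const_mul (2/(Complex.I*(α:ℂ)))
    exact HasDerivAt.congr_deriv (f := Omg α δ) this (by simp)
  have d1 : HasDerivAt (fun z : ℂ => (2/(α:ℂ)) * ((zP α δ μ : ℂ) - z)) (-(2/(α:ℂ))) z := by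
    have := ((hasDerivAt_id z).const_sub (zP α δ μ : ℂ)).const_mul (2/(α:ℂ))
    exact this.congr_deriv (by simp)
  have t1 := (xlogx_deriv d1 h.h1).const_mul (-2:ℂ)
  have t2 := (xlogx_deriv ((dR.const_sub (-Complex.I * (μ:ℂ))).div_const 2) h.h2).const_mul Complex.I
  have t3 := (xlogx_deriv ((dR.const_add (-Complex.I * (μ:ℂ))).div_const 2) h.h3).const_mul Complex.I
  have t4 := (xlogx_deriv (dO.sub (dR.div_const 2)) h.h4).const_mul Complex.I
  have t5 := (xlogx_deriv (dO.add (dR.div_const 2)) h.h5).const_mul Complex.I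
  have := ((((t1.add t2).add t3).sub t4).sub t5).const_add (-(μ:ℂ) * Complex.log 2)
  have hR0 := h.ne
  refine (this.congr_deriv ?_).congr_of_eventuallyEq (Eventually.of_forall fun w => ?_)
  · simp only [PhiD, Pi.sub_apply, Pi.add_apply]
    generalize Complex.log _ = X1
    generalize Complex.log _ = X2
    generalize Complex.log _ = X3
    generalize Complex.log _ = X4
    generalize Complex.log _ = X5
    have hI : 2/(Complex.I * α) = -(2*Complex.I/α) := by
      field_simp; linear_combination (1:ℂ)*Complex.I_sq
    rw [hI]
    field_simp
    ring_nf
    simp only [Complex.I_sq]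
    ring
  · simp only [Phi, Pi.sub_apply, Pi.add_apply]
    generalize Complex.log _ = X0
    generalize Complex.log _ = X1
    generalize Complex.log _ = X2
    generalize Complex.log _ = X3
    generalize Complex.log _ = X4
    generalize Complex.log _ = X5
    ring_nf
    simp only [Complex.I_sq]
    ring

lemma Good.cont {α δ μ : ℝ} {z : ℂ} (h : Good α δ μ z) : ContinuousAt (PhiD α δ μ) z := by
  have cR : ContinuousAt (Rf μ) z := (Rf_hasDeriv h.h0).continuousAt
  have cO : ContinuousAt (Omg α δ) z := by unfold Omg; fun_prop
  have hR0 := h.ne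
  unfold PhiD
  have c1 : ContinuousAt (fun z : ℂ => Complex.log ((2/(α:ℂ)) * ((zP α δ μ : ℂ) - z))) z :=
    ContinuousAt.clog (by fun_prop) h.h1
  have c2 : ContinuousAt (fun z : ℂ => Complex.log ((-Complex.I * (μ:ℂ) - Rf μ z)/2)) z :=
    ContinuousAt.clog (by fun_prop) h.h2
  have c3 : ContinuousAt (fun z : ℂ => Complex.log ((-Complex.I * (μ:ℂ) + Rf μ z)/2)) z :=
    ContinuousAt.clog (by fun_prop) h.h3
  have c4 : ContinuousAt (fun z : ℂ => Complex.log (Omg α δ z - Rf μ z / 2)) z :=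
    ContinuousAt.clog (by fun_prop) h.h4
  have c5 : ContinuousAt (fun z : ℂ => Complex.log (Omg α δ z + Rf μ z / 2)) z :=
    ContinuousAt.clog (by fun_prop) h.h5
  fun_prop (disch := assumption)

lemma Good.eventually {α δ μ : ℝ} {z : ℂ} (h : Good α δ μ z) : ∀ᶠ w in 𝓝 z, Good α δ μ w := by
  have cR : ContinuousAt (Rf μ) z := (Rf_hasDeriv h.h0).continuousAt
  have cO : ContinuousAt (Omg α δ) z := by unfold Omg; fun_prop
  have op := Complex.isOpen_slitPlane
  have c0 : ContinuousAt (fun z : ℂ => -Complex.I * (16 * z - (μ:ℂ)^2)) z := by fun_prop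
  have c1 : ContinuousAt (fun z : ℂ => (2/(α:ℂ)) * ((zP α δ μ : ℂ) - z)) z := by fun_prop
  have c2 : ContinuousAt (fun z : ℂ => (-Complex.I * (μ:ℂ) - Rf μ z)/2) z := by fun_prop
  have c3 : ContinuousAt (fun z : ℂ => (-Complex.I * (μ:ℂ) + Rf μ z)/2) z := by fun_prop
  have c4 : ContinuousAt (fun z : ℂ => Omg α δ z - Rf μ z / 2) z := by fun_prop
  have c5 : ContinuousAt (fun z : ℂ => Omg α δ z + Rf μ z / 2) z := by fun_prop
  filter_upwards [c0.eventually (op.mem_nhds h.h0), c1.eventually (op.mem_nhds h.h1),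
    c2.eventually (op.mem_nhds h.h2), c3.eventually (op.mem_nhds h.h3),
    c4.eventually (op.mem_nhds h.h4), c5.eventually (op.mem_nhds h.h5)] with w a0 a1 a2 a3 a4 a5
  exact ⟨a0, a1, a2, a3, a4, a5⟩

lemma Good.limit {α δ μ : ℝ} (hα : 0 < α) {s : ℝ} (h : Good α δ μ s) {v : ℂ}
    (hv : Tendsto (deriv (Phi α δ μ)) (𝓝[{z : ℂ | 0 < z.im}] (s:ℂ)) (𝓝 v)) :
    v = PhiD α δ μ s := by
  have h1 : Tendsto (deriv (Phi α δ μ)) (𝓝 (s:ℂ)) (𝓝 (PhiD α δ μ s)) := by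
    refine h.cont.tendsto.congr' ?_
    filter_upwards [h.eventually] with w hw using (hw.hasDeriv hα).deriv.symm
  have hne : (𝓝[{z : ℂ | 0 < z.im}] (s:ℂ)).NeBot := by
    rw [← mem_closure_iff_nhdsWithin_neBot]
    have : closure {z : ℂ | 0 < z.im} = {z : ℂ | 0 ≤ z.im} := Complex.closure_setOfPred_lt_im 0
    rw [this]; simp
  exact tendsto_nhds_unique hv (h1.mono_left nhdsWithin_le_nhds)

lemma Omg_real (α δ : ℝ) (hα : 0 < α) (s : ℝ) :
    Omg α δ s = Complex.I * (((1 - α*δ - 4*s)/(2*α) : ℝ) : ℂ) := by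
  have hα' : (α:ℂ) ≠ 0 := by exact_mod_cast hα.ne'
  unfold Omg
  push_cast
  field_simp
  linear_combination 4*(4 * (s:ℂ) - (1 - α * δ))*Complex.I_sq

lemma Rf_lt {μ s : ℝ} (h : 16*s < μ^2) : Rf μ s = Complex.I * (Real.sqrt (μ^2-16*s) : ℂ) := by
  unfold Rf
  have e : -Complex.I * (16 * (s:ℂ) - (μ:ℂ)^2) = ((μ^2-16*s : ℝ):ℂ) * Complex.I := by push_cast; ring
  have h0 : 0 < μ^2-16*s := by linarith
  rw [e, Complex.cpow_def_of_ne_zero (mul_ne_zero (by exact_mod_cast h0.ne') (by simp)), 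
    Complex.log_ofReal_mul h0 Complex.I_ne_zero, Complex.log_I, ← Complex.exp_add]
  have : Complex.I * (π:ℂ)/4 + (((Real.log (μ^2-16*s) : ℝ) : ℂ) + (π:ℂ)/2*Complex.I)*(1/2)
     = ((Real.log (μ^2-16*s)/2 : ℝ) : ℂ) + (π:ℂ)/2*Complex.I := by push_cast; ring
  rw [this, Complex.exp_add, Complex.exp_pi_div_two_mul_I, ← Complex.ofReal_exp, mul_comm,
    Real.sqrt_eq_rpow, Real.rpow_def_of_pos h0]
  congr 4
  ring

lemma Rf_gt {μ s : ℝ} (h : μ^2 < 16*s) : Rf μ s = (Real.sqrt (16*s-μ^2) : ℂ) := by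
  unfold Rf
  have e : -Complex.I * (16 * (s:ℂ) - (μ:ℂ)^2) = ((16*s-μ^2 : ℝ):ℂ) * (-Complex.I) := by push_cast; ring
  have h0 : 0 < 16*s-μ^2 := by linarith
  rw [e, Complex.cpow_def_of_ne_zero (mul_ne_zero (by exact_mod_cast h0.ne') (by simp)), 
    Complex.log_ofReal_mul h0 (by simp), Complex.log_neg_I, ← Complex.exp_add]
  have : Complex.I * (π:ℂ)/4 + (((Real.log (16*s-μ^2) : ℝ) : ℂ) + -((π:ℂ)/2)*Complex.I)*(1/2)
     = ((Real.log (16*s-μ^2)/2 : ℝ) : ℂ) := by push_cast; ring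
  rw [this, ← Complex.ofReal_exp,
    Real.sqrt_eq_rpow, Real.rpow_def_of_pos h0]
  congr 4
  ring

lemma h0_real {μ s : ℝ} (h : 16*s ≠ μ^2) :
    -Complex.I * (16 * (s:ℂ) - (μ:ℂ)^2) ∈ Complex.slitPlane := by
  right
  have e : -Complex.I * (16 * (s:ℂ) - (μ:ℂ)^2) = ((μ^2-16*s : ℝ):ℂ) * Complex.I := by push_cast; ring
  have e2 : (((μ^2-16*s : ℝ):ℂ) * Complex.I).im = μ^2-16*s := by
    rw [Complex.im_ofReal_mul]; simp only [Complex.I_im, mul_one]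
  rw [e, e2]
  intro h2; apply h; linarith

/-- parameter relations -/
structure Par (α δ μ p : ℝ) : Prop where
  hα : 0 < α
  hp : 0 < p
  hpm : p < μ
  hmb : μ < p + 4*α
  ha : 4*(1 - α*δ) = μ^2 - p^2 - 4*p*α

lemma Par.zP_eq {α δ μ p : ℝ} (h : Par α δ μ p) : 16 * zP α δ μ = (μ - p)*(μ + (p + 4*α)) := by
  unfold zP; linarith [h.ha]

lemma clogI_pos {y : ℝ} (hy : 0 < y) : Complex.log (Complex.I * (y:ℂ)) = (Real.log y : ℂ) + (π/2 : ℝ)*Complex.I := by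
  rw [mul_comm, Complex.log_ofReal_mul hy Complex.I_ne_zero, Complex.log_I]; push_cast; ring

lemma clogI_neg {y : ℝ} (hy : y < 0) : Complex.log (Complex.I * (y:ℂ)) = (Real.log (-y) : ℂ) - (π/2 : ℝ)*Complex.I := by
  have : Complex.I * (y:ℂ) = ((-y:ℝ):ℂ) * (-Complex.I) := by push_cast; ring
  rw [this, Complex.log_ofReal_mul (by linarith) (by simp), Complex.log_neg_I]; push_cast; ring

lemma I_mul_slit {y : ℝ} (hy : y ≠ 0) : Complex.I * (y:ℂ) ∈ Complex.slitPlane := by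
  right; simpa using hy

lemma first_arg (α δ μ s : ℝ) : (2/(α:ℂ)) * ((zP α δ μ : ℂ) - s) = (((2/α)*(zP α δ μ - s) : ℝ) : ℂ) := by
  push_cast; ring

lemma args_lt {α δ μ p s x : ℝ} (h : Par α δ μ p) (hx : 0 < x) (hs : 16*s = μ^2 - x^2) :
    Rf μ s = Complex.I * (x:ℂ) ∧
    (-Complex.I * (μ:ℂ) - Rf μ s)/2 = Complex.I * (((-μ-x)/2 : ℝ) : ℂ) ∧
    (-Complex.I * (μ:ℂ) + Rf μ s)/2 = Complex.I * (((x-μ)/2 : ℝ) : ℂ) ∧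
    Omg α δ s - Rf μ s / 2 = Complex.I * (((x-(p+4*α))*(x+p)/(8*α) : ℝ) : ℂ) ∧
    Omg α δ s + Rf μ s / 2 = Complex.I * (((x+(p+4*α))*(x-p)/(8*α) : ℝ) : ℂ) := by
  have e1 : Rf μ s = Complex.I * (x:ℂ) := by
    rw [Rf_lt (by nlinarith)]
    rw [show μ^2 - 16*s = x^2 by linarith, Real.sqrt_sq hx.le]
  have hα := h.hα
  have hα' : (α:ℂ) ≠ 0 := by exact_mod_cast hα.ne'
  have e2 : (1 - α*δ - 4*s)/(2*α) = (x^2 - p^2 - 4*p*α)/(8*α) := by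
    field_simp; linarith [h.ha]
  refine ⟨e1, ?_, ?_, ?_, ?_⟩
  · rw [e1]; push_cast; ring
  · rw [e1]; push_cast; ring
  · rw [e1, Omg_real α δ hα, e2]; push_cast; field_simp; ring
  · rw [e1, Omg_real α δ hα, e2]; push_cast; field_simp; ring

lemma good_lt {α δ μ p s x : ℝ} (h : Par α δ μ p) (hx : 0 < x) (hs : 16*s = μ^2 - x^2)
    (h1 : x ≠ p) (h2 : x ≠ μ) (h3 : x < p + 4*α) (hz : s < zP α δ μ) : Good α δ μ s := by
  obtain ⟨e1, e2, e3, e4, e5⟩ := args_lt h hx hs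
  have := h.hα
  have := h.hp
  have := h.hpm
  refine ⟨h0_real (by nlinarith), ?_, ?_, ?_, ?_, ?_⟩
  · rw [first_arg]; left
    have : 0 < zP α δ μ - s := by linarith
    rw [Complex.ofReal_re]; positivity
  · rw [e2]; apply I_mul_slit; linarith
  · rw [e3]; apply I_mul_slit; intro h0; apply h2; linarith
  · rw [e4]; apply I_mul_slit
    have : x - (p+4*α) ≠ 0 := by linarith
    positivity
  · rw [e5]; apply I_mul_slit
    have : x - p ≠ 0 := sub_ne_zero.2 h1
    positivity

lemma PhiD_lt {α δ μ p s x : ℝ} (h : Par α δ μ p) (hx : 0 < x) (hs : 16*s = μ^2 - x^2)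
    (hz : s < zP α δ μ) :
    PhiD α δ μ s = ((4/α * Real.log ((2/α)*(zP α δ μ - s)) : ℝ) : ℂ)
      - ((2/α : ℝ):ℂ) * (Complex.log (Complex.I * (((x-(p+4*α))*(x+p)/(8*α) : ℝ) : ℂ))
           + Complex.log (Complex.I * (((x+(p+4*α))*(x-p)/(8*α) : ℝ) : ℂ)))
      + ((4/x : ℝ):ℂ) * (Complex.log (Complex.I * (((x-μ)/2 : ℝ) : ℂ))
           - Complex.log (Complex.I * (((-μ-x)/2 : ℝ) : ℂ))
           - Complex.log (Complex.I * (((x+(p+4*α))*(x-p)/(8*α) : ℝ) : ℂ))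
           + Complex.log (Complex.I * (((x-(p+4*α))*(x+p)/(8*α) : ℝ) : ℂ))) := by
  obtain ⟨e1, e2, e3, e4, e5⟩ := args_lt h hx hs
  unfold PhiD
  rw [e2, e3, e4, e5, e1, first_arg]
  have := h.hα
  have h0 : 0 < zP α δ μ - s := by linarith
  have h4 : 4*Complex.I/(Complex.I * (x:ℂ)) = ((4/x:ℝ):ℂ) := by
    push_cast
    rw [mul_comm, mul_div_mul_left _ _ Complex.I_ne_zero]
  rw [h4, ← Complex.ofReal_log (by positivity)]
  push_cast
  ring

lemma PhiD_main {α δ μ p s x : ℝ} (h : Par α δ μ p) (hx : μ < x) (hxb : x < p+4*α)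
    (hs : 16*s = μ^2 - x^2) (hz : s < zP α δ μ) :
    (PhiD α δ μ s).re = 4/α * Real.log ((2/α)*(zP α δ μ - s))
      - (2/α) * (Real.log (((p+4*α)-x)*(x+p)/(8*α))
           + Real.log ((x+(p+4*α))*(x-p)/(8*α)))
      + (4/x) * (Real.log ((x-μ)/2) - Real.log ((μ+x)/2)
           - Real.log ((x+(p+4*α))*(x-p)/(8*α)) + Real.log (((p+4*α)-x)*(x+p)/(8*α))) := by
  have := h.hα
  have := h.hp
  have := h.hpm
  have x0 : 0 < x := by linarith
  have a1 : 0 < x - p := by linarith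
  have a2 : 0 < p+4*α - x := by linarith
  have a3 : -((x-(p+4*α))*(x+p)/(8*α)) = ((p+4*α)-x)*(x+p)/(8*α) := by ring
  have a4 : 0 < ((p+4*α)-x)*(x+p)/(8*α) := by positivity
  have a5 : -((-μ-x)/2) = (μ+x)/2 := by ring
  rw [PhiD_lt h x0 hs hz, clogI_neg (by linarith), clogI_pos (by positivity), clogI_pos (by linarith),
    clogI_neg (by linarith), a3, a5]
  simp only [Complex.add_re, Complex.sub_re, Complex.re_ofReal_mul, Complex.ofReal_re, Complex.I_re]
  ring

lemma PhiD_im1 {α δ μ p s x : ℝ} (h : Par α δ μ p) (hx : p < x) (hxb : x < μ)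
    (hs : 16*s = μ^2 - x^2) (hz : s < zP α δ μ) :
    (PhiD α δ μ s).im = -(4*π/x) := by
  have := h.hα
  have := h.hp
  have := h.hmb
  have x0 : 0 < x := by linarith
  have a1 : 0 < x - p := by linarith
  have a2 : 0 < p+4*α - x := by linarith
  have a3 : -((x-(p+4*α))*(x+p)/(8*α)) = ((p+4*α)-x)*(x+p)/(8*α) := by ring
  have a4 : 0 < ((p+4*α)-x)*(x+p)/(8*α) := by positivity
  rw [PhiD_lt h x0 hs hz, clogI_neg (by linarith), clogI_pos (by positivity), clogI_neg (by linarith),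
    clogI_neg (by linarith)]
  simp only [Complex.add_im, Complex.sub_im, Complex.im_ofReal_mul, Complex.ofReal_im, Complex.I_im]
  ring

lemma PhiD_im2 {α δ μ p s x : ℝ} (h : Par α δ μ p) (hx : 0 < x) (hxb : x < p)
    (hs : 16*s = μ^2 - x^2) (hz : s < zP α δ μ) :
    (PhiD α δ μ s).im = 2*π/α := by
  have := h.hα
  have := h.hp
  have := h.hpm
  have a1 : 0 < p - x := by linarith
  have a2 : 0 < p+4*α - x := by linarith
  have a3 : -((x-(p+4*α))*(x+p)/(8*α)) = ((p+4*α)-x)*(x+p)/(8*α) := by ring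
  have a4 : 0 < ((p+4*α)-x)*(x+p)/(8*α) := by positivity
  have a5 : -((x+(p+4*α))*(x-p)/(8*α)) = (x+(p+4*α))*(p-x)/(8*α) := by ring
  have a6 : 0 < (x+(p+4*α))*(p-x)/(8*α) := by positivity
  rw [PhiD_lt h hx hs hz, clogI_neg (by linarith), clogI_neg (by linarith), clogI_neg (by linarith),
    clogI_neg (by linarith)]
  simp only [Complex.add_im, Complex.sub_im, Complex.im_ofReal_mul, Complex.ofReal_im, Complex.I_im]
  ring

lemma Par.om_neg {α δ μ p s : ℝ} (h : Par α δ μ p) (hs : μ^2 ≤ 16*s) : (1 - α*δ - 4*s)/(2*α) < 0 := by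
  have := h.hα
  have := h.hp
  apply div_neg_of_neg_of_pos
  · have : 0 < p*α := by positivity
    nlinarith [h.ha]
  · positivity

lemma good_gt {α δ μ p s : ℝ} (h : Par α δ μ p) (hs : μ^2 < 16*s) (hz : s < zP α δ μ) :
    Good α δ μ s := by
  have := h.hα
  have := h.hp
  have := h.hpm
  have hom := h.om_neg hs.le
  have eR := Rf_gt hs
  set r := Real.sqrt (16*s-μ^2) with hr
  set w := (1 - α*δ - 4*s)/(2*α) with hw
  refine ⟨h0_real (by linarith), ?_, ?_, ?_, ?_, ?_⟩
  · rw [first_arg]; left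
    have : 0 < zP α δ μ - s := by linarith
    rw [Complex.ofReal_re]; positivity
  · right; rw [eR]; simp; linarith
  · right; rw [eR]; simp; linarith
  · right; rw [eR, Omg_real α δ h.hα, ← hw]; clear_value w; simpa using hom.ne
  · right; rw [eR, Omg_real α δ h.hα, ← hw]; clear_value w; simpa using hom.ne

lemma log_pair {w v : ℂ} (hw : w.im < 0) (hv : v = -(conj w)) :
    (Complex.log v).re = (Complex.log w).re ∧ (Complex.log v).im + (Complex.log w).im = -π := by
  subst hv
  refine ⟨by simp [Complex.log_re], ?_⟩
  simp only [Complex.log_im]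
  rw [Complex.arg_neg_eq_arg_sub_pi_of_im_pos (by simpa using hw), Complex.arg_conj, if_neg]
  · ring
  · intro h; rw [Complex.arg_eq_pi_iff] at h; linarith [h.2]

lemma PhiD_im3 {α δ μ p s : ℝ} (h : Par α δ μ p) (hs : μ^2 < 16*s) (hz : s < zP α δ μ) :
    (PhiD α δ μ s).im = 2*π/α := by
  have := h.hα
  have := h.hp
  have := h.hpm
  have hom := h.om_neg hs.le
  have eR := Rf_gt hs
  unfold PhiD
  rw [eR, Omg_real α δ h.hα]
  set r := Real.sqrt (16*s-μ^2) with hr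
  set w := (1 - α*δ - 4*s)/(2*α) with hw
  have h0 : 0 < zP α δ μ - s := by linarith
  have c2 : conj (2:ℂ) = 2 := map_ofNat _ 2
  obtain ⟨p1, p2⟩ := log_pair (w := Complex.I*(w:ℂ) + (r:ℂ)/2) (v := Complex.I*(w:ℂ) - (r:ℂ)/2)
    (by simpa using hom) (by simp [c2]; ring)
  obtain ⟨p3, p4⟩ := log_pair (w := (-Complex.I*(μ:ℂ) + (r:ℂ))/2) (v := (-Complex.I*(μ:ℂ) - (r:ℂ))/2)
    (by simp; linarith) (by simp [c2]; ring)
  rw [first_arg, ← Complex.ofReal_log (by positivity)]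
  generalize Complex.log (Complex.I*(w:ℂ) + (r:ℂ)/2) = A at *
  generalize Complex.log (Complex.I*(w:ℂ) - (r:ℂ)/2) = B at *
  generalize Complex.log ((-Complex.I*(μ:ℂ) + (r:ℂ))/2) = C at *
  generalize Complex.log ((-Complex.I*(μ:ℂ) - (r:ℂ))/2) = D at *
  have e : (4/(α:ℂ)) = ((4/α:ℝ):ℂ) := by push_cast; rfl
  have e' : (2/(α:ℂ)) = ((2/α:ℝ):ℂ) := by push_cast; rfl
  have e'' : (4*Complex.I/(r:ℂ)) = ((4/r:ℝ):ℂ)*Complex.I := by push_cast; ring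
  rw [e, e', e'', mul_assoc]
  simp only [Complex.add_im, Complex.sub_im, Complex.im_ofReal_mul, Complex.ofReal_im, 
    Complex.I_mul_im, Complex.add_re, Complex.sub_re]
  rw [p1, p3, p2]
  ring

lemma ii_ofReal {f : ℝ → ℝ} {a b : ℝ} (h : IntervalIntegrable f volume a b) :
    IntervalIntegrable (fun s => ((f s : ℝ) : ℂ)) volume a b := ⟨h.1.ofReal, h.2.ofReal⟩

lemma ii_clogI {f : ℝ → ℝ} {a b : ℝ} (hf : AnalyticOnNhd ℝ f (uIcc a b)) :
    IntervalIntegrable (fun s => Complex.log (Complex.I * (f s : ℂ))) volume a b := by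
  have h1 : IntervalIntegrable (fun s => Real.log ‖f s‖) volume a b :=
    MeromorphicOn.intervalIntegrable_log_norm hf.meromorphicOn
  have hc : ContinuousOn f (uIcc a b) := hf.continuousOn
  have h2 : IntervalIntegrable (fun s => Complex.arg (Complex.I * (f s : ℂ))) volume a b := by
    have hm : AEStronglyMeasurable (fun s => Complex.arg (Complex.I * (f s : ℂ)))
        (volume.restrict (uIoc a b)) := by
      have : AEMeasurable f (volume.restrict (uIoc a b)) :=
        ((hc.mono uIoc_subset_uIcc).aemeasurable measurableSet_uIoc)
      exact (Complex.measurable_arg.comp_aemeasurable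
        ((Complex.measurable_ofReal.comp_aemeasurable this).const_mul _)).aestronglyMeasurable
    refine (intervalIntegrable_const (c := π)).mono_fun hm ?_
    refine Eventually.of_forall fun s => ?_
    simp only [Real.norm_eq_abs]
    rw [abs_of_pos Real.pi_pos]
    exact Complex.abs_arg_le_pi _
  have h3 : IntervalIntegrable (fun s => ((Real.log ‖f s‖ : ℝ) : ℂ)) volume a b := ii_ofReal h1
  have h4 : IntervalIntegrable (fun s => ((Complex.arg (Complex.I * (f s : ℂ)) : ℝ) : ℂ)) volume a b :=
    ii_ofReal h2
  refine (h3.add (h4.mul_const Complex.I)).congr ?_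
  intro s _
  simp [Complex.log]

lemma rho_an {μ s : ℝ} (h : 16*s < μ^2) : AnalyticAt ℝ (fun s => Real.sqrt (μ^2 - 16*s)) s := by
  have h2 : AnalyticAt ℝ (fun s : ℝ => Real.exp (Real.log (μ^2 - 16*s) / 2)) s := by
    have : AnalyticAt ℝ (fun s : ℝ => Real.log (μ^2 - 16*s)) s :=
      AnalyticAt.log (by fun_prop) (by linarith)
    fun_prop
  refine h2.congr ?_
  have : ∀ᶠ y in 𝓝 s, 16*y < μ^2 := by
    have : ContinuousAt (fun y : ℝ => 16*y) s := by fun_prop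
    exact this.eventually (Iio_mem_nhds h)
  filter_upwards [this] with y hy
  rw [Real.sqrt_eq_rpow, Real.rpow_def_of_pos (by linarith)]
  congr 1
  ring

lemma ii_left {α δ μ p c : ℝ} (h : Par α δ μ p) (hc0 : 0 < c) (hc : 16*c < μ^2) (hcz : c < zP α δ μ) :
    IntervalIntegrable (fun s : ℝ => PhiD α δ μ s) volume 0 c := by
  have hα := h.hα
  have hr : AnalyticOnNhd ℝ (fun s => Real.sqrt (μ^2 - 16*s)) (uIcc 0 c) := by
    intro s hs
    rw [uIcc_of_le hc0.le] at hs
    exact rho_an (by linarith [hs.2])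
  have A1 := ii_clogI (a := 0) (b := c)
    (f := fun s => (Real.sqrt (μ^2 - 16*s)-(p+4*α))*(Real.sqrt (μ^2 - 16*s)+p)/(8*α))
    (fun s hs => by have := hr s hs; fun_prop)
  have A2 := ii_clogI (a := 0) (b := c)
    (f := fun s => (Real.sqrt (μ^2 - 16*s)+(p+4*α))*(Real.sqrt (μ^2 - 16*s)-p)/(8*α))
    (fun s hs => by have := hr s hs; fun_prop)
  have A3 := ii_clogI (a := 0) (b := c)
    (f := fun s => (Real.sqrt (μ^2 - 16*s)-μ)/2)
    (fun s hs => by have := hr s hs; fun_prop)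
  have A4 := ii_clogI (a := 0) (b := c)
    (f := fun s => (-μ-Real.sqrt (μ^2 - 16*s))/2)
    (fun s hs => by have := hr s hs; fun_prop)
  have C1 : ContinuousOn (fun s => ((4/α * Real.log ((2/α)*(zP α δ μ - s)) : ℝ) : ℂ)) (uIcc 0 c) := by
    intro s hs
    rw [uIcc_of_le hc0.le] at hs
    have : 0 < zP α δ μ - s := by linarith [hs.2]
    have : (2/α)*(zP α δ μ - s) ≠ 0 := by positivity
    apply ContinuousAt.continuousWithinAt
    fun_prop (disch := assumption)
  have C2 : ContinuousOn (fun s => ((4/Real.sqrt (μ^2 - 16*s) : ℝ) : ℂ)) (uIcc 0 c) := by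
    intro s hs
    rw [uIcc_of_le hc0.le] at hs
    have : Real.sqrt (μ^2-16*s) ≠ 0 := (Real.sqrt_pos.2 (by linarith [hs.2])).ne'
    apply ContinuousAt.continuousWithinAt
    fun_prop (disch := assumption)
  have B := (C1.intervalIntegrable.sub ((A1.add A2).const_mul ((2/α : ℝ):ℂ))).add
    (((A3.sub A4).sub A2 |>.add A1).continuousOn_mul C2)
  refine B.congr ?_
  intro s hs
  rw [uIoc_of_le hc0.le] at hs
  simp only []
  rw [PhiD_lt h (x := Real.sqrt (μ^2-16*s)) (Real.sqrt_pos.2 (by linarith [hs.2]))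
    (by rw [Real.sq_sqrt (by linarith [hs.2])]; ring) (by linarith [hs.2])]

lemma Rf_cont (μ : ℝ) : Continuous (fun s : ℝ => Rf μ s) := by
  unfold Rf
  rw [continuous_iff_continuousAt]
  intro s
  have e : (fun s : ℝ => -Complex.I * (16 * (s:ℂ) - (μ:ℂ)^2)) = fun s : ℝ => ((μ^2-16*s : ℝ):ℂ) * Complex.I := by
    ext s; push_cast; ring
  have := Complex.continuousAt_cpow_const_of_re_pos (z := -Complex.I * (16 * (s:ℂ) - (μ:ℂ)^2)) (w := (1:ℂ)/2)
    (Or.inl (by rw [congrFun e s, Complex.re_ofReal_mul]; simp)) (by norm_num)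
  have h2 : ContinuousAt (fun s : ℝ => -Complex.I * (16 * (s:ℂ) - (μ:ℂ)^2)) s := by fun_prop
  exact (ContinuousAt.comp (f := fun s : ℝ => -Complex.I * (16 * (s:ℂ) - (μ:ℂ)^2)) this h2).const_mul _
  
lemma Rf_inv_ii (μ a b : ℝ) : IntervalIntegrable (fun s : ℝ => (Rf μ s)⁻¹) volume a b := by
  have h0 : IntervalIntegrable (fun x : ℝ => |x| ^ (-(1/2) : ℝ)) volume (16*a-μ^2) (16*b-μ^2) := by
    have := (intervalIntegral.intervalIntegrable_cpow' (a := 16*a-μ^2) (b := 16*b-μ^2)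
      (r := ((-(1/2):ℝ):ℂ)) (by rw [Complex.ofReal_re]; norm_num)).norm
    refine this.congr ?_
    intro x _
    simp only [Complex.norm_cpow_real, Complex.norm_real, Real.norm_eq_abs]
  have h1 : IntervalIntegrable (fun s : ℝ => |16*s-μ^2| ^ (-(1/2) : ℝ)) volume a b := by
    have h2 := (h0.comp_sub_right (μ^2)).comp_mul_left (c := 16)
    have e1 : (16*a-μ^2+μ^2)/16 = a := by ring
    have e2 : (16*b-μ^2+μ^2)/16 = b := by ring
    rw [e1, e2] at h2
    exact h2
  refine h1.mono_fun ((Rf_cont μ).measurable.inv.aestronglyMeasurable) (Eventually.of_forall fun s => ?_)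
  simp only [norm_inv]
  have : ‖Rf μ s‖^2 = |16*s-μ^2| := by
    rw [← norm_pow, Rf_sq, ← Real.norm_eq_abs, ← Complex.norm_real]; push_cast; rfl
  rw [Real.rpow_neg (abs_nonneg _), ← Real.sqrt_eq_rpow, ← this, Real.sqrt_sq (norm_nonneg _)]
  simp

lemma ii_right {α δ μ p c : ℝ} (h : Par α δ μ p) (hc : μ^2 - p^2 < 16*c) (hcz : c < zP α δ μ) :
    IntervalIntegrable (fun s : ℝ => PhiD α δ μ s) volume c (zP α δ μ) := by
  have hα := h.hα
  have hp := h.hp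
  have hpm := h.hpm
  have hR := Rf_cont μ
  have hO : Continuous (fun s : ℝ => Omg α δ s) := by unfold Omg; fun_prop
  -- imaginary parts
  have key : ∀ s ∈ uIcc c (zP α δ μ), ((-Complex.I * (μ:ℂ) - Rf μ s)/2).im < 0 ∧
     ((-Complex.I * (μ:ℂ) + Rf μ s)/2).im < 0 ∧ (Omg α δ s - Rf μ s / 2).im < 0 ∧
     (Omg α δ s + Rf μ s / 2).im < 0 := by
    intro s hs
    rw [uIcc_of_le hcz.le] at hs
    rcases lt_or_ge (16*s) (μ^2) with h1 | h1
    · have x0 : 0 < Real.sqrt (μ^2-16*s) := Real.sqrt_pos.2 (by linarith)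
      have xs := Real.sq_sqrt (show 0 ≤ μ^2-16*s by linarith)
      set x := Real.sqrt (μ^2-16*s)
      have xp : x < p := by nlinarith [hs.1]
      obtain ⟨e1, e2, e3, e4, e5⟩ := args_lt h x0 (s := s) (by linarith)
      rw [e2, e3, e4, e5]
      simp only [Complex.I_mul_im, Complex.ofReal_re]
      have i1 : 0 < p - x := by linarith
      have i2 : 0 < p + 4*α - x := by linarith
      have a4 : 0 < ((p+4*α)-x)*(x+p)/(8*α) := by positivity
      have a6 : 0 < (x+(p+4*α))*(p-x)/(8*α) := by positivity
      have a3 : -((x-(p+4*α))*(x+p)/(8*α)) = ((p+4*α)-x)*(x+p)/(8*α) := by ring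
      have a5 : -((x+(p+4*α))*(x-p)/(8*α)) = (x+(p+4*α))*(p-x)/(8*α) := by ring
      refine ⟨by linarith, by linarith, by linarith, by linarith⟩
    · have hom := h.om_neg h1
      have hre : (Rf μ s).im = 0 := by
        rcases h1.eq_or_lt with h2 | h2
        · have := Rf_sq μ s
          have h3 : (16 * (s:ℂ) - (μ:ℂ)^2) = 0 := by
            have : ((16*s - μ^2 : ℝ):ℂ) = 0 := by rw [← h2]; simp
            rw [← this]; push_cast; ring
          rw [h3] at this
          rw [pow_eq_zero_iff (by norm_num)] at this
          rw [this]; simp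
        · rw [Rf_gt h2]; simp
      rw [Omg_real α δ h.hα]
      set w := (1 - α*δ - 4*s)/(2*α) with hw
      clear_value w
      have h2 : ∀ z : ℂ, (z/2).im = z.im/2 := by intro z; simp
      simp only [h2, Complex.add_im, Complex.sub_im, Complex.I_mul_im, Complex.ofReal_re, hre, 
        Complex.neg_im, neg_mul]
      refine ⟨by linarith, by linarith, by linarith, by linarith⟩
  have sl : ∀ z : ℂ, z.im < 0 → z ∈ Complex.slitPlane := fun z hz => Or.inr hz.ne
  have C2 : ContinuousOn (fun s : ℝ => Complex.log ((-Complex.I * (μ:ℂ) - Rf μ s)/2)) (uIcc c (zP α δ μ)) :=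
    ContinuousOn.clog (((continuous_const.sub hR).div_const 2).continuousOn) fun s hs => sl _ (key s hs).1
  have C3 : ContinuousOn (fun s : ℝ => Complex.log ((-Complex.I * (μ:ℂ) + Rf μ s)/2)) (uIcc c (zP α δ μ)) :=
    ContinuousOn.clog (((continuous_const.add hR).div_const 2).continuousOn) fun s hs => sl _ (key s hs).2.1
  have C4 : ContinuousOn (fun s : ℝ => Complex.log (Omg α δ s - Rf μ s / 2)) (uIcc c (zP α δ μ)) :=
    ContinuousOn.clog (by fun_prop) fun s hs => sl _ (key s hs).2.2.1
  have C5 : ContinuousOn (fun s : ℝ => Complex.log (Omg α δ s + Rf μ s / 2)) (uIcc c (zP α δ μ)) :=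
    ContinuousOn.clog (by fun_prop) fun s hs => sl _ (key s hs).2.2.2
  have I1 : IntervalIntegrable (fun s : ℝ => ((Real.log ‖(2/α)*(zP α δ μ - s)‖ : ℝ) : ℂ)) volume c (zP α δ μ) :=
    ii_ofReal (MeromorphicOn.intervalIntegrable_log_norm
      (f := fun s => (2/α)*(zP α δ μ - s)) (fun s _ => AnalyticAt.meromorphicAt (by fun_prop)))
  have D1 : ContinuousOn (fun s : ℝ => (2/(α:ℂ)) * (Complex.log (Omg α δ s - Rf μ s / 2) + Complex.log (Omg α δ s + Rf μ s / 2)))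
    (uIcc c (zP α δ μ)) := by fun_prop
  have D2 : ContinuousOn (fun s : ℝ => (4*Complex.I) * (Complex.log ((-Complex.I * (μ:ℂ) + Rf μ s)/2)
     - Complex.log ((-Complex.I * (μ:ℂ) - Rf μ s)/2)
     - Complex.log (Omg α δ s + Rf μ s / 2) + Complex.log (Omg α δ s - Rf μ s / 2)))
    (uIcc c (zP α δ μ)) := by fun_prop
  have B := ((I1.const_mul (4/(α:ℂ))).sub D1.intervalIntegrable).add ((Rf_inv_ii μ c (zP α δ μ)).mul_continuousOn D2)
  refine B.congr ?_
  intro s hs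
  rw [uIoc_of_le hcz.le] at hs
  simp only []
  unfold PhiD
  have : 0 ≤ zP α δ μ - s := by linarith [hs.2]
  rw [first_arg, ← Complex.ofReal_log (by positivity), Real.norm_of_nonneg (by positivity)]
  ring

lemma ii_all {α δ μ p : ℝ} (h : Par α δ μ p) :
    IntervalIntegrable (fun s : ℝ => PhiD α δ μ s) volume 0 (zP α δ μ) := by
  have hα := h.hα
  have hp := h.hp
  have hpm := h.hpm
  have e := h.zP_eq
  have a1 : μ^2 - p^2 < 16 * zP α δ μ := by nlinarith
  have a2 : 0 < μ^2 - p^2 := by nlinarith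
  have a3 : 0 < p^2 := by positivity
  obtain ⟨c, hc1, hc2⟩ := exists_between (show (μ^2-p^2)/16 < min (zP α δ μ) (μ^2/16) from
    lt_min (by linarith) (by linarith))
  rw [lt_min_iff] at hc2
  exact (ii_left h (by linarith) (by linarith) hc2.1).trans (ii_right h (by linarith) hc2.1)

lemma Phip_eq {α δ μ p : ℝ} (h : Par α δ μ p) (hzp : 16 * zplus α δ μ = μ^2 - p^2) {Φp : ℝ → ℂ}
    (hΦp : ∀ s : ℝ, 0 < s → s < zP α δ μ → s ≠ zplus α δ μ →
      Filter.Tendsto (deriv (Phi α δ μ)) (𝓝[{z : ℂ | 0 < z.im}] (s:ℂ)) (𝓝 (Φp s)))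
    {s : ℝ} (h0 : 0 < s) (h1 : s < zP α δ μ) (h2 : s ≠ zplus α δ μ) (h3 : s ≠ μ^2/16) :
    Φp s = PhiD α δ μ s := by
  have hα := h.hα
  have hp := h.hp
  have hpm := h.hpm
  have hmb := h.hmb
  apply Good.limit hα _ (hΦp s h0 h1 h2)
  rcases lt_or_gt_of_ne h3 with h4 | h4
  · have x0 : 0 < Real.sqrt (μ^2-16*s) := Real.sqrt_pos.2 (by linarith)
    have xs := Real.sq_sqrt (show 0 ≤ μ^2-16*s by linarith)
    set x := Real.sqrt (μ^2-16*s)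
    have xm : x < μ := by nlinarith
    refine good_lt h x0 (by linarith) ?_ xm.ne (by linarith) h1
    intro hx; apply h2; rw [hx] at xs; linarith
  · exact good_gt h (by linarith) h1

lemma rho_hasDeriv {μ s : ℝ} (h : 16*s < μ^2) :
    HasDerivAt (fun s => Real.sqrt (μ^2 - 16*s)) (-8 / Real.sqrt (μ^2-16*s)) s := by
  have h1 : HasDerivAt (fun s : ℝ => μ^2 - 16*s) (-16) s := by
    simpa using ((hasDerivAt_id s).const_mul 16).const_sub (μ^2)
  refine (h1.sqrt (by linarith)).congr_deriv ?_
  have : 0 < Real.sqrt (μ^2-16*s) := Real.sqrt_pos.2 (by linarith)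
  field_simp
  norm_num

lemma int_first {μ p z x : ℝ} (hp : 0 < p) (hpm : p < μ) (hx : μ < x) (hz : 16*z = μ^2 - x^2) :
    ∫ s in (0:ℝ)..((μ^2-p^2)/16), -(4*π/Real.sqrt (μ^2-16*s))/(s - z)
      = -(4*π/x) * ((Real.log (x+μ) - Real.log (x-μ)) - (Real.log (x+p) - Real.log (x-p))) := by
  have hle : (0:ℝ) ≤ (μ^2-p^2)/16 := by
    have : 0 < (μ-p)*(μ+p) := mul_pos (by linarith) (by linarith)
    linarith
  have hz0 : z < 0 := by
    have : 0 < (x-μ)*(x+μ) := mul_pos (by linarith) (by linarith)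
    linarith
  have p2 : 0 < p^2 := by positivity
  have hd : ∀ s ∈ uIcc (0:ℝ) ((μ^2-p^2)/16), HasDerivAt
      (fun s => (4*π/x) * (Real.log (x+Real.sqrt (μ^2-16*s)) - Real.log (x-Real.sqrt (μ^2-16*s))))
      (-(4*π/Real.sqrt (μ^2-16*s))/(s - z)) s := by
    intro s hs
    rw [uIcc_of_le hle] at hs
    have hs' : 16*s < μ^2 := by linarith [hs.2]
    have hr := rho_hasDeriv hs'
    have x0 : 0 < Real.sqrt (μ^2-16*s) := Real.sqrt_pos.2 (by linarith)
    have xs := Real.sq_sqrt (show 0 ≤ μ^2-16*s by linarith)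
    have xm : Real.sqrt (μ^2-16*s) ≤ μ := by
      rw [Real.sqrt_le_left (by linarith)]; linarith [hs.1]
    have d1 := (hr.const_add x).log (by linarith)
    have d2 := (hr.const_sub x).log (by linarith)
    refine ((d1.sub d2).const_mul (4*π/x)).congr_deriv ?_
    set r := Real.sqrt (μ^2-16*s)
    have e : s - z = (x-r)*(x+r)/16 := by linarith
    have : x - r ≠ 0 := by linarith
    have : x + r ≠ 0 := by linarith
    have : x ≠ 0 := by linarith
    rw [e]
    field_simp
    ring
  rw [intervalIntegral.integral_eq_sub_of_hasDerivAt hd]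
  · have e1 : Real.sqrt (μ^2 - 16*((μ^2-p^2)/16)) = p := by
      rw [show μ^2 - 16*((μ^2-p^2)/16) = p^2 by ring, Real.sqrt_sq hp.le]
    have e2 : Real.sqrt (μ^2 - 16*0) = μ := by
      rw [mul_zero, sub_zero, Real.sqrt_sq (by linarith)]
    rw [e1, e2]; ring
  · apply ContinuousOn.intervalIntegrable
    intro s hs
    rw [uIcc_of_le hle] at hs
    have : Real.sqrt (μ^2-16*s) ≠ 0 := (Real.sqrt_pos.2 (by linarith [hs.2])).ne'
    have : s - z ≠ 0 := by linarith [hs.1]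
    apply ContinuousAt.continuousWithinAt
    fun_prop (disch := assumption)

lemma int_second {α a b z : ℝ} (hza : z < a) (hab : a ≤ b) :
    ∫ s in a..b, (2*π/α)/(s - z) = (2*π/α) * (Real.log (b-z) - Real.log (a-z)) := by
  have hd : ∀ s ∈ uIcc a b, HasDerivAt (fun s => (2*π/α) * Real.log (s-z)) ((2*π/α)/(s - z)) s := by
    intro s hs
    rw [uIcc_of_le hab] at hs
    have := (((hasDerivAt_id s).sub_const z).log (by simp; linarith [hs.1])).const_mul (2*π/α)
    refine this.congr_deriv ?_
    simp [div_eq_mul_inv]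
  rw [intervalIntegral.integral_eq_sub_of_hasDerivAt hd]
  · ring
  · apply ContinuousOn.intervalIntegrable
    intro s hs
    rw [uIcc_of_le hab] at hs
    have : s - z ≠ 0 := by linarith [hs.1]
    apply ContinuousAt.continuousWithinAt
    fun_prop (disch := assumption)

lemma ae_off (a b c : ℝ) : ∀ᵐ s : ℝ, s ≠ a ∧ s ≠ b ∧ s ≠ c := by
  have := ({a, b, c} : Set ℝ).toFinite.countable.ae_notMem (volume : Measure ℝ)
  filter_upwards [this] with s hs
  simpa using hs

lemma int_val {α δ μ p : ℝ} (h : Par α δ μ p) (hzp : 16 * zplus α δ μ = μ^2 - p^2) {Φp : ℝ → ℂ}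
    (hΦp : ∀ s : ℝ, 0 < s → s < zP α δ μ → s ≠ zplus α δ μ →
      Filter.Tendsto (deriv (Phi α δ μ)) (𝓝[{z : ℂ | 0 < z.im}] (s:ℂ)) (𝓝 (Φp s)))
    {z x : ℝ} (hx : μ < x) (hz : 16*z = μ^2 - x^2) :
    (∫ s in (0:ℝ)..(zP α δ μ), Φp s / ((s:ℂ) - (z:ℂ))).im
      = -(4*π/x) * ((Real.log (x+μ) - Real.log (x-μ)) - (Real.log (x+p) - Real.log (x-p)))
       + (2*π/α) * (Real.log (zP α δ μ - z) - Real.log ((μ^2-p^2)/16-z)) := by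
  have hα := h.hα
  have hp := h.hp
  have hpm := h.hpm
  have hmb := h.hmb
  have e := h.zP_eq
  have a1 : μ^2 - p^2 < 16 * zP α δ μ := by nlinarith
  have a2 : 0 < μ^2 - p^2 := by nlinarith
  have a3 : 0 < p^2 := by positivity
  have hz0 : z < 0 := by
    have : 0 < (x-μ)*(x+μ) := mul_pos (by linarith) (by linarith)
    linarith
  have c1 : ∫ s in (0:ℝ)..(zP α δ μ), Φp s / ((s:ℂ) - (z:ℂ))
      = ∫ s in (0:ℝ)..(zP α δ μ), PhiD α δ μ s / ((s:ℂ) - (z:ℂ)) := by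
    apply intervalIntegral.integral_congr_ae
    filter_upwards [ae_off (zP α δ μ) (zplus α δ μ) (μ^2/16)] with s hs hs2
    rw [uIoc_of_le (by linarith)] at hs2
    rw [Phip_eq h hzp hΦp hs2.1 (lt_of_le_of_ne hs2.2 hs.1) hs.2.1 hs.2.2]
  have ii : IntervalIntegrable (fun s : ℝ => PhiD α δ μ s / ((s:ℂ) - (z:ℂ))) volume 0 (zP α δ μ) := by
    simp only [div_eq_mul_inv]
    apply (ii_all h).mul_continuousOn
    intro s hs
    rw [uIcc_of_le (by linarith)] at hs
    have : (s:ℂ) - (z:ℂ) ≠ 0 := by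
      rw [← Complex.ofReal_sub, Complex.ofReal_ne_zero]; linarith [hs.1]
    apply ContinuousAt.continuousWithinAt
    fun_prop (disch := assumption)
  have c2 := Complex.imCLM.intervalIntegral_comp_comm ii
  simp only [Complex.imCLM_apply] at c2
  have e2 : ∀ s : ℝ, (PhiD α δ μ s / ((s:ℂ) - (z:ℂ))).im = (PhiD α δ μ s).im / (s - z) := by
    intro s
    rw [← Complex.ofReal_sub, Complex.div_ofReal_im]
  have ii2 : IntervalIntegrable (fun s : ℝ => (PhiD α δ μ s).im / (s - z)) volume 0 (zP α δ μ) := by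
    have : IntervalIntegrable (fun s : ℝ => (PhiD α δ μ s / ((s:ℂ) - (z:ℂ))).im) volume 0 (zP α δ μ) :=
      ⟨ii.1.im, ii.2.im⟩
    simpa only [e2] using this
  rw [c1, ← c2]
  simp only [e2]
  have m1 : uIcc 0 ((μ^2-p^2)/16) ⊆ uIcc 0 (zP α δ μ) := by
    rw [uIcc_of_le (by linarith), uIcc_of_le (by linarith)]
    exact Icc_subset_Icc_right (by linarith)
  have m2 : uIcc ((μ^2-p^2)/16) (zP α δ μ) ⊆ uIcc 0 (zP α δ μ) := by
    rw [uIcc_of_le (by linarith), uIcc_of_le (by linarith)]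
    exact Icc_subset_Icc_left (by linarith)
  rw [← intervalIntegral.integral_add_adjacent_intervals (ii2.mono_set m1) (ii2.mono_set m2)]
  congr 1
  · rw [← int_first hp hpm hx hz]
    apply intervalIntegral.integral_congr_ae
    filter_upwards [ae_off ((μ^2-p^2)/16) (zplus α δ μ) (μ^2/16)] with s hs hs2
    rw [uIoc_of_le (by linarith)] at hs2
    have hs3 := lt_of_le_of_ne hs2.2 hs.1
    have xs := Real.sq_sqrt (show 0 ≤ μ^2-16*s by linarith)
    rw [PhiD_im1 h (x := Real.sqrt (μ^2-16*s))]
    · exact Real.lt_sqrt_of_sq_lt (by linarith)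
    · rw [Real.sqrt_lt' (by linarith)]; linarith [hs2.1]
    · linarith
    · linarith
  · rw [← int_second (by linarith) (by linarith)]
    apply intervalIntegral.integral_congr_ae
    filter_upwards [ae_off (zP α δ μ) (zplus α δ μ) (μ^2/16)] with s hs hs2
    rw [uIoc_of_le (by linarith)] at hs2
    have hs3 := lt_of_le_of_ne hs2.2 hs.1
    rcases lt_or_gt_of_ne hs.2.2 with h4 | h4
    · have xs := Real.sq_sqrt (show 0 ≤ μ^2-16*s by linarith)
      rw [PhiD_im2 h (x := Real.sqrt (μ^2-16*s)) (Real.sqrt_pos.2 (by linarith)) _ (by linarith) hs3]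
      rw [Real.sqrt_lt' hp]; linarith [hs2.1]
    · rw [PhiD_im3 h (by linarith) hs3]

lemma Ft_eq {α δ μ p : ℝ} (h : Par α δ μ p) (hzp : 16 * zplus α δ μ = μ^2 - p^2) {Φp : ℝ → ℂ}
    (hΦp : ∀ s : ℝ, 0 < s → s < zP α δ μ → s ≠ zplus α δ μ →
      Filter.Tendsto (deriv (Phi α δ μ)) (𝓝[{z : ℂ | 0 < z.im}] (s:ℂ)) (𝓝 (Φp s)))
    {z x t : ℝ} (hx : μ < x) (hxb : x < p + 4*α) (hz : 16*z = μ^2 - x^2) :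
    Ft α δ μ Φp t z = fX α μ (gX α p μ) t x := by
  have hα := h.hα
  have hp := h.hp
  have hpm := h.hpm
  have hmb := h.hmb
  have e := h.zP_eq
  have a1 : μ^2 - p^2 < 16 * zP α δ μ := by nlinarith
  have a2 : 0 < μ^2 - p^2 := by nlinarith
  have hz0 : z < 0 := by
    have : 0 < (x-μ)*(x+μ) := mul_pos (by linarith) (by linarith)
    linarith
  have hg := good_lt h (by linarith) hz (by linarith) (by linarith) hxb (by linarith)
  have x0 : 0 < x := by linarith
  have i1 : 0 < x - p := by linarith
  have i2 : 0 < x + p := by linarith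
  have i3 : 0 < x - μ := by linarith
  have i4 : 0 < x + μ := by linarith
  have i5 : 0 < p + 4*α - x := by linarith
  have i6 : 0 < p + 4*α + x := by linarith
  have i7 : 0 < zP α δ μ - z := by linarith
  unfold Ft I0c
  rw [(hg.hasDeriv hα).deriv, PhiD_main h hx hxb hz (by linarith), int_val h hzp hΦp hx hz]
  have l1 : Real.log (2/α*(zP α δ μ - z)) = Real.log 2 - Real.log α + Real.log (zP α δ μ - z) := by
    rw [Real.log_mul (by positivity) (by positivity), Real.log_div (by positivity) (by positivity)]
  have l8 : Real.log (8*α) = 3*Real.log 2 + Real.log α := by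
    rw [Real.log_mul (by positivity) (by positivity), show (8:ℝ) = 2^3 by norm_num, Real.log_pow]; norm_num
  have l2 : Real.log ((p+4*α-x)*(x+p)/(8*α)) = Real.log (p+4*α-x) + Real.log (x+p) - (3*Real.log 2 + Real.log α) := by
    rw [Real.log_div (by positivity) (by positivity), Real.log_mul (by positivity) (by positivity), l8]
  have l3 : Real.log ((x+(p+4*α))*(x-p)/(8*α)) = Real.log (p+4*α+x) + Real.log (x-p) - (3*Real.log 2 + Real.log α) := by
    rw [add_comm x, Real.log_div (by positivity) (by positivity), Real.log_mul (by positivity) (by positivity), l8]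
  have l4 : Real.log ((x-μ)/2) = Real.log (x-μ) - Real.log 2 := Real.log_div (by positivity) (by positivity)
  have l5 : Real.log ((μ+x)/2) = Real.log (x+μ) - Real.log 2 := by
    rw [add_comm μ, Real.log_div (by positivity) (by positivity)]
  have l6 : Real.log ((μ^2-p^2)/16-z) = Real.log (x-p) + Real.log (x+p) - 4*Real.log 2 := by
    rw [show (μ^2-p^2)/16-z = (x-p)*(x+p)/2^4 by linarith, Real.log_div (by positivity) (by positivity),
      Real.log_mul (by positivity) (by positivity), Real.log_pow]; norm_num
  rw [l1, l2, l3, l4, l5, l6]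
  unfold fX gX
  have hz' : z = (μ^2-x^2)/16 := by linarith
  have hpi := Real.pi_pos
  generalize Real.log (zP α δ μ - z) = A1
  rw [hz']
  field_simp
  ring

lemma exists_par {α δ μ : ℝ} (hα : 0 < α)
    (hT1 : α * |μ| > |1 - α*δ|) (hT2 : μ^2 > 4*(1 - α*δ)) (hT3 : 0 < μ) :
    ∃ p, Par α δ μ p ∧ 16 * zplus α δ μ = μ^2 - p^2 ∧ 16 * zminus α δ μ = μ^2 - (p+4*α)^2 := by
  rw [abs_of_pos hT3] at hT1
  obtain ⟨h1, h2⟩ := abs_lt.1 hT1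
  have hpos : 0 < 4*α^2 + μ^2 - 4*(1-α*δ) := by nlinarith
  set q := Real.sqrt (4*α^2 + μ^2 - 4*(1-α*δ)) with hq
  have q2 : q^2 = 4*α^2 + μ^2 - 4*(1-α*δ) := Real.sq_sqrt hpos.le
  have q0 : 0 < q := Real.sqrt_pos.2 hpos
  have hd : Real.sqrt (discrm α δ μ) = α*q/2 := by
    rw [show discrm α δ μ = (α*q/2)^2 by unfold discrm; rw [div_pow, mul_pow, q2]; ring]
    exact Real.sqrt_sq (by positivity)
  refine ⟨q - 2*α, ⟨hα, ?_, ?_, ?_, ?_⟩, ?_, ?_⟩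
  · nlinarith
  · have : q < μ + 2*α := lt_of_pow_lt_pow_left₀ 2 (by positivity) (by nlinarith)
    linarith
  · have : μ - 2*α < q := lt_of_pow_lt_pow_left₀ 2 q0.le (by nlinarith)
    linarith
  · nlinarith
  · unfold zplus; rw [hd]; nlinarith
  · unfold zminus; rw [hd]; nlinarith

/-- the caustic function `x_c(t)` as a smooth minimum value. -/
theorem caustic_minimization (α δ μ : ℝ) (hα : 0 < α)
    (hT1 : α * |μ| > |1 - α*δ|) (hT2 : μ^2 > 4*(1 - α*δ)) (hT3 : 0 < μ)
    (Φp : ℝ → ℂ)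
    (hΦp : ∀ s : ℝ, 0 < s → s < zP α δ μ → s ≠ zplus α δ μ →
      Filter.Tendsto (deriv (Phi α δ μ)) (𝓝[{z : ℂ | 0 < z.im}] (s:ℂ)) (𝓝 (Φp s))) :
    (∀ t : ℝ, 0 ≤ t →
      -- (i) divergence at the endpoints of (z_L, 0)
      Filter.Tendsto (Ft α δ μ Φp t) (𝓝[>] (zminus α δ μ)) Filter.atTop ∧
      Filter.Tendsto (Ft α δ μ Φp t) (𝓝[<] (0:ℝ)) Filter.atTop ∧
      -- (ii) a unique critical point which is the unique global minimizer
      ∃ zc ∈ Set.Ioo (zminus α δ μ) 0,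
        deriv (Ft α δ μ Φp t) zc = 0 ∧
        (∀ z' ∈ Set.Ioo (zminus α δ μ) 0, deriv (Ft α δ μ Φp t) z' = 0 → z' = zc) ∧
        (∀ z' ∈ Set.Ioo (zminus α δ μ) 0, z' ≠ zc →
          Ft α δ μ Φp t zc < Ft α δ μ Φp t z') ∧
        -- (iii) the minimum value is attained
        Ft α δ μ Φp t zc = sInf (Ft α δ μ Φp t '' Set.Ioo (zminus α δ μ) 0)) ∧
    -- (iii) smooth dependence of the minimum value on t
    ContDiffOn ℝ (⊤ : ℕ∞)
      (fun t => sInf (Ft α δ μ Φp t '' Set.Ioo (zminus α δ μ) 0)) (Set.Ici 0) := by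
  obtain ⟨p, h, hzp, hzm⟩ := exists_par hα hT1 hT2 hT3
  have hp := h.hp
  have hpm := h.hpm
  have hmb := h.hmb
  obtain ⟨κ, hκ, hh⟩ := h_mono hα hp hpm
  have tm := gX_tendsto_m hα hp hpm hmb
  have tb := gX_tendsto_b hα hp hpm hmb
  obtain ⟨M1, M2⟩ := abs_main hα hp.le hpm hmb hκ
    (fun x hx => gX_hasDeriv hα hp hpm hx.1 hx.2)
    (fun x hx => gdX_contDiff hp hpm hx.1 hx.2) (fun x hx => gX_contDiff hp hpm hx.1 hx.2) hh tm tb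
  -- the change of variables
  have hb : 0 < p + 4*α := by linarith
  have hrho : ∀ z ∈ Ioo (zminus α δ μ) 0, Real.sqrt (μ^2-16*z) ∈ Ioo μ (p+4*α) ∧
      16*z = μ^2 - (Real.sqrt (μ^2-16*z))^2 := by
    intro z hz
    have hz2 := hz.2
    refine ⟨⟨?_, ?_⟩, ?_⟩
    · exact Real.lt_sqrt_of_sq_lt (by linarith)
    · rw [Real.sqrt_lt' hb]; linarith [hz.1]
    · rw [Real.sq_sqrt (by nlinarith)]; ring
  have hinv : ∀ x ∈ Ioo μ (p+4*α), (μ^2-x^2)/16 ∈ Ioo (zminus α δ μ) 0 ∧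
      Real.sqrt (μ^2-16*((μ^2-x^2)/16)) = x := by
    intro x hx
    obtain ⟨x1, x2⟩ := hx
    refine ⟨⟨?_, ?_⟩, ?_⟩
    · nlinarith
    · nlinarith
    · rw [show μ^2-16*((μ^2-x^2)/16) = x^2 by ring, Real.sqrt_sq (by linarith)]
  have hF : ∀ t, ∀ z ∈ Ioo (zminus α δ μ) 0,
      Ft α δ μ Φp t z = fX α μ (gX α p μ) t (Real.sqrt (μ^2-16*z)) := by
    intro t z hz
    obtain ⟨h1, h2⟩ := hrho z hz
    exact Ft_eq h hzp hΦp h1.1 h1.2 h2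
  have him : ∀ t, Ft α δ μ Φp t '' Set.Ioo (zminus α δ μ) 0 = fX α μ (gX α p μ) t '' Ioo μ (p+4*α) := by
    intro t
    ext y
    constructor
    · rintro ⟨z, hz, rfl⟩
      exact ⟨_, (hrho z hz).1, (hF t z hz).symm⟩
    · rintro ⟨x, hx, rfl⟩
      obtain ⟨h1, h2⟩ := hinv x hx
      exact ⟨_, h1, by rw [hF t _ h1, h2]⟩
  have hder : ∀ t, ∀ z ∈ Ioo (zminus α δ μ) 0, deriv (Ft α δ μ Φp t) z
      = deriv (fX α μ (gX α p μ) t) (Real.sqrt (μ^2-16*z)) * (-8/Real.sqrt (μ^2-16*z)) := by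
    intro t z hz
    have hz2 := hz.2
    have h1 := (hrho z hz).1
    have e : Ft α δ μ Φp t =ᶠ[𝓝 z] (fX α μ (gX α p μ) t) ∘ (fun z => Real.sqrt (μ^2-16*z)) := by
      filter_upwards [Ioo_mem_nhds hz.1 hz.2] with w hw using hF t w hw
    rw [e.deriv_eq]
    have d1 := fX_hasDeriv α μ (gX α p μ) (gdX α p μ) t _ (gX_hasDeriv hα hp hpm h1.1 h1.2)
    exact (d1.differentiableAt.hasDerivAt.comp z (rho_hasDeriv (by nlinarith))).deriv
  have hder0 : ∀ t, ∀ z ∈ Ioo (zminus α δ μ) 0, deriv (Ft α δ μ Φp t) z = 0 ↔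
      deriv (fX α μ (gX α p μ) t) (Real.sqrt (μ^2-16*z)) = 0 := by
    intro t z hz
    have h1 := (hrho z hz).1.1
    have : -8/Real.sqrt (μ^2-16*z) ≠ 0 := div_ne_zero (by norm_num) (by linarith)
    rw [hder t z hz]
    simp [this]
  have hzm0 : zminus α δ μ < 0 := by nlinarith
  have hcont : Continuous (fun z : ℝ => Real.sqrt (μ^2-16*z)) := by fun_prop
  refine ⟨?_, ?_⟩
  · intro t ht
    refine ⟨?_, ?_, ?_⟩
    · have T : Tendsto (fun z : ℝ => Real.sqrt (μ^2-16*z)) (𝓝[>] (zminus α δ μ)) (𝓝[<] (p+4*α)) := by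
        refine tendsto_nhdsWithin_of_tendsto_nhds_of_eventually_within _ ?_ ?_
        · have := hcont.tendsto (zminus α δ μ)
          rw [hzm, show μ^2 - (μ^2-(p+4*α)^2) = (p+4*α)^2 by ring, Real.sqrt_sq hb.le] at this
          exact this.mono_left nhdsWithin_le_nhds
        · filter_upwards [Ioo_mem_nhdsGT hzm0] with z hz using (hrho z hz).1.2
      refine ((abs_tendsto α μ (gX α p μ) t _ _ nhdsWithin_le_nhds tb).comp T).congr' ?_
      filter_upwards [Ioo_mem_nhdsGT hzm0] with z hz using (hF t z hz).symm
    · have T : Tendsto (fun z : ℝ => Real.sqrt (μ^2-16*z)) (𝓝[<] (0:ℝ)) (𝓝[>] μ) := by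
        refine tendsto_nhdsWithin_of_tendsto_nhds_of_eventually_within _ ?_ ?_
        · have := hcont.tendsto (0:ℝ)
          rw [mul_zero, sub_zero, Real.sqrt_sq hT3.le] at this
          exact this.mono_left nhdsWithin_le_nhds
        · filter_upwards [Ioo_mem_nhdsLT hzm0] with z hz using (hrho z hz).1.1
      refine ((abs_tendsto α μ (gX α p μ) t _ _ nhdsWithin_le_nhds tm).comp T).congr' ?_
      filter_upwards [Ioo_mem_nhdsLT hzm0] with z hz using (hF t z hz).symm
    · obtain ⟨xc, hxc, m1, m2, m3, m4⟩ := M1 t ht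
      obtain ⟨h1, h2⟩ := hinv xc hxc
      refine ⟨_, h1, ?_, ?_, ?_, ?_⟩
      · rw [hder0 t _ h1, h2]; exact m1
      · intro z hz hz0
        rw [hder0 t z hz] at hz0
        obtain ⟨r1, r2⟩ := hrho z hz
        have := m2 _ r1 hz0
        rw [this] at r2
        linarith
      · intro z hz hne
        obtain ⟨r1, r2⟩ := hrho z hz
        rw [hF t _ h1, h2, hF t z hz]
        refine m3 _ r1 ?_
        intro heq
        apply hne
        rw [heq] at r2
        linarith
      · rw [him t, hF t _ h1, h2]; exact m4
  · simp only [him]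
    exact M2
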